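/- arXiv:1907.03825 — 2 statements merged into one kernel-verified Lean document; each statement's English description precedes it below -/
import Mathlib

section
/- Let f : [a,b] → X be strongly McShane integrable on [a,b], let Z₁ = { t₁ ∈ [a₁,b₁] : the section f_{t₁} is not strongly McShane integrable on [a₂,b₂] }, Z₂ = { t₂ ∈ [a₂,b₂] : the section f_{t₂} is not strongly McShane integrable on [a₁,b₁] }, Z = (Z₁ × [a₂,b₂]) ∪ ([a₁,b₁] × Z₂), and f₀ = f·𝟙_{[a,b]∖Z}. Then f₀ is strongly McShane integrable on [a,b], and for every t₁ ∈ [a₁,b₁] the section (f₀)_{t₁} is strongly McShane integrable on [a₂,b₂] and for every t₂ ∈ [a₂,b₂] the section (f₀)_{t₂} is strongly McShane integrable on [a₁,b₁]. -/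
open Set MeasureTheory

variable {E : Type*} [MeasureSpace E] [PseudoMetricSpace E] [Preorder E]
variable {X : Type*} [NormedAddCommGroup X] [NormedSpace ℝ X]

/-- The closed interval of a tagged item `(t, p, q)` is `[p, q]` (the tag is `t`). -/
def itemBox (x : E × E × E) : Set E := Set.Icc x.2.1 x.2.2

/-- `[p,q]` is a closed non-degenerate subinterval of `K`. -/
def IsSubinterval (K : Set E) (p q : E) : Prop :=
  Set.Icc p q ⊆ K ∧ (interior (Set.Icc p q)).Nonempty

/-- `P` is an `𝓜`-partition of `K`: a finite collection of tagged pairwise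
non-overlapping closed non-degenerate subintervals of `K` covering `K`, with tags in `K`. -/
def IsMPartition (K : Set E) (P : Finset (E × E × E)) : Prop :=
  (∀ x ∈ P, x.1 ∈ K ∧ IsSubinterval K x.2.1 x.2.2) ∧
  (∀ x ∈ P, ∀ y ∈ P, x ≠ y → interior (itemBox x) ∩ interior (itemBox y) = ∅) ∧
  (⋃ x ∈ P, itemBox x) = K

/-- `𝓗𝓚`-partition: an `𝓜`-partition each of whose tags belongs to its interval. -/
def IsHKPartition (K : Set E) (P : Finset (E × E × E)) : Prop :=
  IsMPartition K P ∧ ∀ x ∈ P, x.1 ∈ itemBox x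

/-- A gauge on `K`: positive on `K`. -/
def IsGauge (K : Set E) (δ : E → ℝ) : Prop := ∀ t ∈ K, 0 < δ t

/-- A tagged partition is `δ`-fine if each interval lies in the open ball
around its tag of radius `δ(tag)`. -/
def IsFine (δ : E → ℝ) (P : Finset (E × E × E)) : Prop :=
  ∀ x ∈ P, itemBox x ⊆ Metric.ball x.1 (δ x.1)

/-- `f` is McShane integrable on `K` with integral `v`. -/
def HasMcShaneIntegral (K : Set E) (f : E → X) (v : X) : Prop :=
  ∀ ε > 0, ∃ δ : E → ℝ, IsGauge K δ ∧
    ∀ P : Finset (E × E × E), IsMPartition K P → IsFine δ P →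
      ‖(∑ x ∈ P, (volume (itemBox x)).toReal • f x.1) - v‖ < ε

/-- `f` is Henstock–Kurzweil integrable on `K` with integral `v`. -/
def HasHKIntegral (K : Set E) (f : E → X) (v : X) : Prop :=
  ∀ ε > 0, ∃ δ : E → ℝ, IsGauge K δ ∧
    ∀ P : Finset (E × E × E), IsHKPartition K P → IsFine δ P →
      ‖(∑ x ∈ P, (volume (itemBox x)).toReal • f x.1) - v‖ < ε

/-- An additive interval function on the non-degenerate closed subintervals of `K`
(an interval is recorded by its pair of corners). -/
def IsAdditiveIntervalFun (K : Set E) (F : E × E → X) : Prop :=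
  ∀ p q r s u w : E, IsSubinterval K p q → IsSubinterval K r s → IsSubinterval K u w →
    interior (Set.Icc p q) ∩ interior (Set.Icc r s) = ∅ →
    Set.Icc p q ∪ Set.Icc r s = Set.Icc u w →
    F (u, w) = F (p, q) + F (r, s)

/-- `f` is strongly McShane integrable on `[a,b]` with `(M)∫_{[a,b]} f = v`. -/
def HasStrongMcShaneIntegral (a b : E) (f : E → X) (v : X) : Prop :=
  ∃ F : E × E → X, IsAdditiveIntervalFun (Set.Icc a b) F ∧ F (a, b) = v ∧
    ∀ ε > 0, ∃ δ : E → ℝ, IsGauge (Set.Icc a b) δ ∧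
      ∀ P : Finset (E × E × E), IsMPartition (Set.Icc a b) P → IsFine δ P →
        ∑ x ∈ P, ‖(volume (itemBox x)).toReal • f x.1 - F (x.2.1, x.2.2)‖ < ε

/-- `f` is strongly Henstock–Kurzweil integrable on `[a,b]` with `(HK)∫_{[a,b]} f = v`. -/
def HasStrongHKIntegral (a b : E) (f : E → X) (v : X) : Prop :=
  ∃ F : E × E → X, IsAdditiveIntervalFun (Set.Icc a b) F ∧ F (a, b) = v ∧
    ∀ ε > 0, ∃ δ : E → ℝ, IsGauge (Set.Icc a b) δ ∧
      ∀ P : Finset (E × E × E), IsHKPartition (Set.Icc a b) P → IsFine δ P →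
        ∑ x ∈ P, ‖(volume (itemBox x)).toReal • f x.1 - F (x.2.1, x.2.2)‖ < ε

/-- Property `𝓢*𝓜` on `[a,b]`. -/
def PropSM (a b : E) (f : E → X) : Prop :=
  ∀ ε > 0, ∃ δ : E → ℝ, IsGauge (Set.Icc a b) δ ∧
    ∀ P Q : Finset (E × E × E),
      IsMPartition (Set.Icc a b) P → IsFine δ P →
      IsMPartition (Set.Icc a b) Q → IsFine δ Q →
      ∑ x ∈ P, ∑ y ∈ Q, ‖f x.1 - f y.1‖ * (volume (itemBox x ∩ itemBox y)).toReal < ε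

/-- Property `𝓢*𝓗𝓚` on `[a,b]`. -/
def PropSHK (a b : E) (f : E → X) : Prop :=
  ∀ ε > 0, ∃ δ : E → ℝ, IsGauge (Set.Icc a b) δ ∧
    ∀ P Q : Finset (E × E × E),
      IsHKPartition (Set.Icc a b) P → IsFine δ P →
      IsHKPartition (Set.Icc a b) Q → IsFine δ Q →
      ∑ x ∈ P, ∑ y ∈ Q, ‖f x.1 - f y.1‖ * (volume (itemBox x ∩ itemBox y)).toReal < ε



theorem aedisjoint_Icc_of_interior_inter_eq_empty
    (hnull : ∀ p q : E, volume (frontier (Icc p q)) = 0) {p q r s : E}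
    (h : interior (Icc p q) ∩ interior (Icc r s) = ∅) :
    AEDisjoint volume (Icc p q) (Icc r s) := by
  refine measure_mono_null (fun x hx => ?_)
    (measure_union_null (hnull p q) (hnull r s))
  by_contra hc
  simp only [frontier, mem_union, mem_sdiff, not_or, not_and, not_not] at hc
  exact (Set.eq_empty_iff_forall_notMem.1 h x)
    ⟨hc.1 (subset_closure hx.1), hc.2 (subset_closure hx.2)⟩

/-- A Bochner integrable function is strongly McShane integrable. -/
theorem hasStrongMcShaneIntegral_of_integrableOn
    [BorelSpace E] [OrderClosedTopology E] [CompactIccSpace E] [ProperSpace E]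
    [IsFiniteMeasureOnCompacts (volume : Measure E)] [CompleteSpace X]
    (hnull : ∀ p q : E, volume (frontier (Icc p q)) = 0)
    {a b : E} {f : E → X} (hf : IntegrableOn f (Icc a b)) :
    HasStrongMcShaneIntegral a b f (∫ s in Icc a b, f s) := by
  refine ⟨fun I => ∫ s in Icc I.1 I.2, f s, ?_, rfl, ?_⟩
  · intro p q r s u w hpq hrs huw hd hU
    simp only
    rw [← hU, setIntegral_union₀ (aedisjoint_Icc_of_interior_inter_eq_empty hnull hd)
      isClosed_Icc.measurableSet.nullMeasurableSet (hf.mono_set hpq.1) (hf.mono_set hrs.1)]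
  intro ε hε
  have : IsFiniteMeasure (volume.restrict (Icc a b)) :=
    ⟨by simpa using isCompact_Icc.measure_lt_top⟩
  set μ := volume.restrict (Icc a b) with hμ
  set c : ℝ := (volume (Icc a b)).toReal with hc
  have hcv : volume (Icc a b) = ENNReal.ofReal c :=
    (ENNReal.ofReal_toReal isCompact_Icc.measure_lt_top.ne).symm
  have hc0 : 0 ≤ c := ENNReal.toReal_nonneg
  set e : ℝ := ε / (c + 4) with he
  have he0 : 0 < e := by positivity
  have hee : ENNReal.ofReal e ≠ 0 := by simpa using he0
  obtain ⟨g, -, hg, hgc, hgi⟩ := Integrable.exists_hasCompactSupport_lintegral_sub_le hf hee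
  have hfg : AEStronglyMeasurable (fun x => f x - g x) μ :=
    hf.aestronglyMeasurable.sub hgi.aestronglyMeasurable
  obtain ⟨u, hu, hulsc, hui⟩ := exists_lt_lowerSemicontinuous_lintegral_ge_of_aemeasurable μ
    (fun x => ‖f x - g x‖₊) hfg.nnnorm.aemeasurable (ε := e.toNNReal)
    (by simpa using hee)
  have key : ∀ t, ∃ r > 0, ∀ s ∈ Metric.ball t r,
      (‖f t - g t‖₊ : ENNReal) < u s ∧ ‖g t - g s‖ < e := by
    intro t
    have h1 := hulsc t _ (hu t)
    have h2 : ∀ᶠ s in nhds t, dist (g s) (g t) < e :=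
      (Metric.tendsto_nhds.1 hgc.continuousAt) e he0
    obtain ⟨r, hr, h⟩ := Metric.eventually_nhds_iff_ball.1 (h1.and h2)
    exact ⟨r, hr, fun s hs => ⟨(h s hs).1, by
      simpa [dist_eq_norm, norm_sub_rev] using (h s hs).2⟩⟩
  choose δ hδ hδs using key
  refine ⟨δ, fun t _ => hδ t, fun P hP hfine => ?_⟩
  set G : E → ENNReal := fun s => u s + ENNReal.ofReal e + ‖f s - g s‖ₑ with hG
  have h1 : ∀ x ∈ P, ‖(volume (itemBox x)).toReal • f x.1 - ∫ s in Icc x.2.1 x.2.2, f s‖ₑ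
      ≤ ∫⁻ s in itemBox x, G s := by
    intro x hx
    have hsub : itemBox x ⊆ Icc a b := (hP.1 x hx).2.1
    have hfin : volume (itemBox x) < ⊤ := isCompact_Icc.measure_lt_top
    have : (volume (itemBox x)).toReal • f x.1 - ∫ s in Icc x.2.1 x.2.2, f s
        = ∫ s in itemBox x, (f x.1 - f s) := by
      rw [integral_sub (by simp [isFiniteMeasure_restrict, hfin.ne])
        (hf.mono_set hsub)]
      simp [Measure.real, itemBox]
    rw [this]
    refine (enorm_integral_le_lintegral_enorm _).trans
      (setLIntegral_mono' isClosed_Icc.measurableSet fun s hs => ?_)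
    obtain ⟨h1, h2⟩ := hδs x.1 s (hfine x hx hs)
    have : f x.1 - f s = (f x.1 - g x.1) + (g x.1 - g s) - (f s - g s) := by abel
    rw [this]
    refine (enorm_sub_le).trans (add_le_add ((enorm_add_le _ _).trans (add_le_add h1.le ?_)) le_rfl)
    rw [← ofReal_norm]
    exact ENNReal.ofReal_le_ofReal h2.le
  have h2 : ∑ x ∈ P, ∫⁻ s in itemBox x, G s = ∫⁻ s, G s ∂μ := by
    rw [hμ, ← hP.2.2, lintegral_biUnion_finset₀]
    · intro x hx y hy hxy
      exact aedisjoint_Icc_of_interior_inter_eq_empty hnull (hP.2.1 x hx y hy hxy)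
    · intro x _
      exact isClosed_Icc.measurableSet.nullMeasurableSet
  have h3 : ∫⁻ s, G s ∂μ ≤ ENNReal.ofReal ((c + 3) * e) := by
    have : ∫⁻ s, G s ∂μ = ∫⁻ s, u s ∂μ + ENNReal.ofReal e * volume (Icc a b)
        + ∫⁻ s, ‖f s - g s‖ₑ ∂μ := by
      rw [hG, lintegral_add_right' _ hfg.enorm, lintegral_add_right _ measurable_const]
      simp [hμ]
    rw [this, hcv]
    calc _ ≤ (ENNReal.ofReal e + ENNReal.ofReal e) + ENNReal.ofReal e * ENNReal.ofReal c
          + ENNReal.ofReal e := by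
          gcongr
          refine hui.trans (add_le_add ?_ le_rfl)
          exact hg
      _ = _ := by
          rw [← ENNReal.ofReal_mul he0.le, ← ENNReal.ofReal_add, ← ENNReal.ofReal_add,
            ← ENNReal.ofReal_add] <;> first | positivity | (congr 1; ring)
  have h4 : ENNReal.ofReal (∑ x ∈ P,
      ‖(volume (itemBox x)).toReal • f x.1 - ∫ s in Icc x.2.1 x.2.2, f s‖)
      ≤ ENNReal.ofReal ((c + 3) * e) := by
    rw [ENNReal.ofReal_sum_of_nonneg fun _ _ => norm_nonneg _]
    simp only [ofReal_norm]
    exact (Finset.sum_le_sum h1).trans (h2.trans_le h3)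
  have h5 := (ENNReal.ofReal_le_ofReal_iff (by positivity)).1 h4
  refine h5.trans_lt ?_
  rw [he, mul_div_assoc', div_lt_iff₀ (by positivity)]
  nlinarith

theorem HasStrongMcShaneIntegral.congr {a b : E} {f g : E → X} {v : X}
    (hf : HasStrongMcShaneIntegral a b f v) (h : EqOn f g (Icc a b)) :
    HasStrongMcShaneIntegral a b g v := by
  obtain ⟨F, hF, hv, hε⟩ := hf
  refine ⟨F, hF, hv, fun ε h0 => ?_⟩
  obtain ⟨δ, hδ, H⟩ := hε ε h0
  refine ⟨δ, hδ, fun P hP hfine => ?_⟩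
  convert H P hP hfine using 1
  exact Finset.sum_congr rfl fun x hx => by rw [h (hP.1 x hx).1]

theorem HasStrongMcShaneIntegral.sub {a b : E} {f g : E → X} {v w : X}
    (hf : HasStrongMcShaneIntegral a b f v) (hg : HasStrongMcShaneIntegral a b g w) :
    HasStrongMcShaneIntegral a b (fun x => f x - g x) (v - w) := by
  obtain ⟨F, hF, rfl, hFε⟩ := hf
  obtain ⟨G, hG, rfl, hGε⟩ := hg
  refine ⟨fun I => F I - G I, fun p q r s u w h1 h2 h3 h4 h5 => ?_, rfl, fun ε h0 => ?_⟩
  · simp only [hF p q r s u w h1 h2 h3 h4 h5, hG p q r s u w h1 h2 h3 h4 h5]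
    abel
  obtain ⟨δ, hδ, H⟩ := hFε (ε / 2) (half_pos h0)
  obtain ⟨η, hη, H'⟩ := hGε (ε / 2) (half_pos h0)
  refine ⟨fun t => min (δ t) (η t), fun t ht => lt_min (hδ t ht) (hη t ht),
    fun P hP hfine => ?_⟩
  have h1 := H P hP fun x hx => (hfine x hx).trans (Metric.ball_subset_ball (min_le_left _ _))
  have h2 := H' P hP fun x hx => (hfine x hx).trans (Metric.ball_subset_ball (min_le_right _ _))
  refine lt_of_le_of_lt ?_ ((add_lt_add h1 h2).trans_eq (add_halves ε))
  rw [← Finset.sum_add_distrib]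
  refine Finset.sum_le_sum fun x _ => ?_
  rw [smul_sub, sub_sub_sub_comm]
  exact norm_sub_le _ _

/-- Strong McShane integrability is not affected by changes on a null set. -/
theorem HasStrongMcShaneIntegral.exists_of_ae_eq
    [BorelSpace E] [OrderClosedTopology E] [CompactIccSpace E] [ProperSpace E]
    [IsFiniteMeasureOnCompacts (volume : Measure E)] [CompleteSpace X]
    (hnull : ∀ p q : E, volume (frontier (Icc p q)) = 0)
    {a b : E} {f g : E → X} {v : X} (hf : HasStrongMcShaneIntegral a b f v)
    (h : f =ᵐ[volume.restrict (Icc a b)] g) : ∃ w, HasStrongMcShaneIntegral a b g w := by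
  have h0 : IntegrableOn (fun x => f x - g x) (Icc a b) :=
    (integrable_zero _ _ _).congr (h.mono fun x hx => (sub_eq_zero.2 hx).symm)
  refine ⟨_, (hf.sub (hasStrongMcShaneIntegral_of_integrableOn hnull h0)).congr fun x _ => ?_⟩
  exact sub_sub_cancel _ _

/-- The `i`-th node of the division of `[c, d]` into `N` equal parts. -/
noncomputable def gridNode (c d : ℝ) (N i : ℕ) : ℝ := c + i * ((d - c) / N)

/-- The index of the part of the division of `[c, d]` into `N` equal parts containing `x`. -/
noncomputable def gridNodeIndex (c d : ℝ) (N : ℕ) (x : ℝ) : ℕ := ⌊(x - c) / ((d - c) / N)⌋₊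

section OneDimensional

variable {c d : ℝ} {N : ℕ}

theorem gridNode_zero : gridNode c d N 0 = c := by simp [gridNode]

theorem gridNode_self (hN : 0 < N) : gridNode c d N N = d := by
  unfold gridNode
  field_simp
  ring

theorem gridNode_succ_sub (i : ℕ) :
    gridNode c d N (i + 1) - gridNode c d N i = (d - c) / N := by
  simp only [gridNode]
  push_cast
  ring

theorem gridNode_strictMono (hcd : c < d) (hN : 0 < N) : StrictMono (gridNode c d N) := by
  refine strictMono_nat_of_lt_succ fun i => sub_pos.1 ?_
  rw [gridNode_succ_sub]
  have := sub_pos.2 hcd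
  positivity

theorem exists_mem_Icc_gridNode {x : ℝ} (hx : c ≤ x) (n : ℕ) (hn : 0 < n)
    (hxn : x ≤ gridNode c d N n) :
    ∃ i < n, x ∈ Icc (gridNode c d N i) (gridNode c d N (i + 1)) := by
  induction n with
  | zero => omega
  | succ n ih =>
    rcases le_total (gridNode c d N n) x with h | h
    · exact ⟨n, n.lt_succ_self, h, hxn⟩
    · rcases Nat.eq_zero_or_pos n with rfl | h0
      · exact ⟨0, one_pos, by rwa [gridNode_zero], hxn⟩
      · obtain ⟨i, hi, h⟩ := ih h0 h
        exact ⟨i, hi.trans n.lt_succ_self, h⟩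

theorem gridNode_mul {m : ℕ} (hm : 0 < m) (j : ℕ) :
    gridNode c d (N * m) (m * j) = gridNode c d N j := by
  simp only [gridNode]
  push_cast
  have : (m : ℝ) ≠ 0 := by positivity
  congr 1
  field_simp

theorem gridNode_div_le (hcd : c < d) (hN : 0 < N) {m : ℕ} (hm : 0 < m) (i : ℕ) :
    gridNode c d N (i / m) ≤ gridNode c d (N * m) i := by
  rw [← gridNode_mul hm]
  exact (gridNode_strictMono hcd (Nat.mul_pos hN hm)).monotone (Nat.mul_div_le i m)

theorem gridNode_succ_le (hcd : c < d) (hN : 0 < N) {m : ℕ} (hm : 0 < m) (i : ℕ) :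
    gridNode c d (N * m) (i + 1) ≤ gridNode c d N (i / m + 1) := by
  rw [← gridNode_mul hm (i / m + 1)]
  exact (gridNode_strictMono hcd (Nat.mul_pos hN hm)).monotone (Nat.lt_mul_div_succ i hm)

theorem gridNodeIndex_gridNode (hcd : c < d) (hN : 0 < N) {m : ℕ} (hm : 0 < m) (i : ℕ) :
    gridNodeIndex c d N (gridNode c d (N * m) i) = i / m := by
  have h : (gridNode c d (N * m) i - c) / ((d - c) / N) = (i : ℝ) / m := by
    have := sub_pos.2 hcd
    simp only [gridNode]
    push_cast
    field_simp
    ring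
  rw [gridNodeIndex, h, Nat.floor_div_eq_div]

theorem gridNodeIndex_eq_iff (hcd : c < d) (hN : 0 < N) {x : ℝ} (hx : c ≤ x) (i : ℕ) :
    gridNodeIndex c d N x = i ↔ x ∈ Ico (gridNode c d N i) (gridNode c d N (i + 1)) := by
  have h : 0 < (d - c) / N := div_pos (sub_pos.2 hcd) (by positivity)
  rw [gridNodeIndex, Nat.floor_eq_iff (div_nonneg (sub_nonneg.2 hx) h.le), le_div_iff₀ h,
    div_lt_iff₀ h]
  simp only [gridNode, mem_Ico]
  push_cast
  constructor <;> rintro ⟨h1, h2⟩ <;> constructor <;> linarith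

theorem eventually_gridNodeIndex_eq (hcd : c < d) (hN : 0 < N) {x : ℝ} (hx : c ≤ x)
    (hne : ∀ i, x ≠ gridNode c d N i) :
    ∀ᶠ y in nhds x, gridNodeIndex c d N y = gridNodeIndex c d N x := by
  have h := (gridNodeIndex_eq_iff hcd hN hx _).1 rfl
  have hc : c < x := lt_of_le_of_ne hx fun h => hne 0 (by rw [gridNode_zero, h])
  filter_upwards [Ioo_mem_nhds (lt_of_le_of_ne h.1 (hne _).symm) h.2, lt_mem_nhds hc] with y hy hcy
  exact (gridNodeIndex_eq_iff hcd hN hcy.le _).2 ⟨hy.1.le, hy.2⟩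

theorem measurable_gridNodeIndex : Measurable (gridNodeIndex c d N) :=
  Nat.measurable_floor.comp (by fun_prop)

end OneDimensional

/-- The points of the uniform `N × N` grid of `[a, b] ⊆ ℝ²`. -/
noncomputable def gridPoint (a b : ℝ × ℝ) (N : ℕ) (i : ℕ × ℕ) : ℝ × ℝ :=
  (gridNode a.1 b.1 N i.1, gridNode a.2 b.2 N i.2)

/-- The closed cells of the uniform `N × N` grid of `[a, b] ⊆ ℝ²`. -/
def gridCell (a b : ℝ × ℝ) (N : ℕ) (i : ℕ × ℕ) : Set (ℝ × ℝ) :=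
  Icc (gridPoint a b N i) (gridPoint a b N (i + 1))

/-- The index of the cell of the uniform `N × N` grid of `[a, b] ⊆ ℝ²` containing `x`. -/
noncomputable def gridIndex (a b : ℝ × ℝ) (N : ℕ) (x : ℝ × ℝ) : ℕ × ℕ :=
  (gridNodeIndex a.1 b.1 N x.1, gridNodeIndex a.2 b.2 N x.2)

/-- The set of indices of the cells of an `N × N` grid. -/
def gridIndices (N : ℕ) : Finset (ℕ × ℕ) := Finset.range N ×ˢ Finset.range N

/-- The area of a cell of the uniform `N × N` grid of `[a, b] ⊆ ℝ²`. -/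
noncomputable def gridArea (a b : ℝ × ℝ) (N : ℕ) : ℝ := (b.1 - a.1) / N * ((b.2 - a.2) / N)

/-- The index of the `N × N` cell containing a given cell of the `(N * m) × (N * m)` grid. -/
def coarseIndex (m : ℕ) (i : ℕ × ℕ) : ℕ × ℕ := (i.1 / m, i.2 / m)

/-- A tagging of the cells of the `N × N` grid of `[a, b]` that is fine for the gauge `δ`. -/
def IsFineTagging (a b : ℝ × ℝ) (δ : ℝ × ℝ → ℝ) (N : ℕ) (τ : ℕ × ℕ → ℝ × ℝ) : Prop :=
  ∀ i ∈ gridIndices N, τ i ∈ Icc a b ∧ gridCell a b N i ⊆ Metric.ball (τ i) (δ (τ i))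

theorem mem_gridIndices {N : ℕ} {i : ℕ × ℕ} : i ∈ gridIndices N ↔ i.1 < N ∧ i.2 < N := by
  simp [gridIndices]

theorem coarseIndex_mem {N m : ℕ} {i : ℕ × ℕ} (hi : i ∈ gridIndices (N * m)) :
    coarseIndex m i ∈ gridIndices N := by
  rw [mem_gridIndices] at *
  exact ⟨Nat.div_lt_of_lt_mul (by rw [mul_comm]; exact hi.1),
    Nat.div_lt_of_lt_mul (by rw [mul_comm]; exact hi.2)⟩

section TwoDimensional

variable {a b : ℝ × ℝ} {N : ℕ}

theorem gridCell_eq_prod (i : ℕ × ℕ) : gridCell a b N i =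
    Icc (gridNode a.1 b.1 N i.1) (gridNode a.1 b.1 N (i.1 + 1)) ×ˢ
      Icc (gridNode a.2 b.2 N i.2) (gridNode a.2 b.2 N (i.2 + 1)) := by
  rw [Icc_prod_Icc]
  rfl

theorem interior_gridCell (i : ℕ × ℕ) : interior (gridCell a b N i) =
    Ioo (gridNode a.1 b.1 N i.1) (gridNode a.1 b.1 N (i.1 + 1)) ×ˢ
      Ioo (gridNode a.2 b.2 N i.2) (gridNode a.2 b.2 N (i.2 + 1)) := by
  rw [gridCell_eq_prod, interior_prod_eq, interior_Icc, interior_Icc]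

theorem volume_gridCell (h₁ : a.1 < b.1) (i : ℕ × ℕ) :
    volume (gridCell a b N i) = ENNReal.ofReal (gridArea a b N) := by
  rw [gridCell_eq_prod, Measure.volume_eq_prod, Measure.prod_prod, Real.volume_Icc,
    Real.volume_Icc, gridNode_succ_sub, gridNode_succ_sub, gridArea, ENNReal.ofReal_mul]
  exact div_nonneg (sub_pos.2 h₁).le (Nat.cast_nonneg _)

theorem gridArea_pos (h₁ : a.1 < b.1) (h₂ : a.2 < b.2) (hN : 0 < N) : 0 < gridArea a b N := by
  have := sub_pos.2 h₁
  have := sub_pos.2 h₂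
  unfold gridArea
  positivity

theorem gridCell_subset (h₁ : a.1 < b.1) (h₂ : a.2 < b.2) (hN : 0 < N) {i : ℕ × ℕ}
    (hi : i ∈ gridIndices N) : gridCell a b N i ⊆ Icc a b := by
  rw [mem_gridIndices] at hi
  have m₁ := (gridNode_strictMono h₁ hN).monotone
  have m₂ := (gridNode_strictMono h₂ hN).monotone
  refine Icc_subset_Icc ⟨?_, ?_⟩ ⟨?_, ?_⟩
  · exact gridNode_zero.symm.trans_le (m₁ (Nat.zero_le _))
  · exact gridNode_zero.symm.trans_le (m₂ (Nat.zero_le _))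
  · exact (m₁ hi.1).trans_eq (gridNode_self hN)
  · exact (m₂ hi.2).trans_eq (gridNode_self hN)

theorem Icc_subset_iUnion_gridCell (hN : 0 < N) :
    Icc a b ⊆ ⋃ i ∈ gridIndices N, gridCell a b N i := by
  rintro x ⟨hax, hxb⟩
  obtain ⟨i, hi, hxi⟩ := exists_mem_Icc_gridNode (d := b.1) hax.1 N hN
    (hxb.1.trans_eq (gridNode_self hN).symm)
  obtain ⟨j, hj, hxj⟩ := exists_mem_Icc_gridNode (d := b.2) hax.2 N hN
    (hxb.2.trans_eq (gridNode_self hN).symm)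
  simp only [mem_iUnion]
  refine ⟨(i, j), mem_gridIndices.2 ⟨hi, hj⟩, ?_⟩
  rw [gridCell_eq_prod]
  exact ⟨hxi, hxj⟩

theorem gridCell_subset_gridCell_coarseIndex (h₁ : a.1 < b.1) (h₂ : a.2 < b.2) (hN : 0 < N)
    {m : ℕ} (hm : 0 < m) (i : ℕ × ℕ) :
    gridCell a b (N * m) i ⊆ gridCell a b N (coarseIndex m i) :=
  Icc_subset_Icc ⟨gridNode_div_le h₁ hN hm _, gridNode_div_le h₂ hN hm _⟩
    ⟨gridNode_succ_le h₁ hN hm _, gridNode_succ_le h₂ hN hm _⟩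

theorem gridPoint_mem_gridCell (h₁ : a.1 < b.1) (h₂ : a.2 < b.2) (hN : 0 < N) (i : ℕ × ℕ) :
    gridPoint a b N i ∈ gridCell a b N i :=
  left_mem_Icc.2 ⟨(gridNode_strictMono h₁ hN).monotone (Nat.le_succ _),
    (gridNode_strictMono h₂ hN).monotone (Nat.le_succ _)⟩

theorem interior_gridCell_inter (h₁ : a.1 < b.1) (h₂ : a.2 < b.2) (hN : 0 < N) {i j : ℕ × ℕ}
    (hij : i ≠ j) : interior (gridCell a b N i) ∩ interior (gridCell a b N j) = ∅ := by
  rw [Set.eq_empty_iff_forall_notMem]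
  rintro x ⟨hi, hj⟩
  rw [interior_gridCell] at hi hj
  have aux : ∀ {c d y : ℝ} {k l : ℕ}, c < d →
      y ∈ Ioo (gridNode c d N k) (gridNode c d N (k + 1)) →
      y ∈ Ioo (gridNode c d N l) (gridNode c d N (l + 1)) → k = l := by
    intro c d y k l hcd hk hl
    have m := gridNode_strictMono hcd hN
    have := m.lt_iff_lt.1 (hk.1.trans hl.2)
    have := m.lt_iff_lt.1 (hl.1.trans hk.2)
    omega
  exact hij (Prod.ext (aux h₁ hi.1 hj.1) (aux h₂ hi.2 hj.2))

theorem gridPoint_injective (h₁ : a.1 < b.1) (h₂ : a.2 < b.2) (hN : 0 < N) :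
    Function.Injective (gridPoint a b N) := fun _ _ h =>
  Prod.ext ((gridNode_strictMono h₁ hN).injective (congrArg Prod.fst h))
    ((gridNode_strictMono h₂ hN).injective (congrArg Prod.snd h))

theorem exists_gridCell_subset_ball (h₁ : a.1 < b.1) {r : ℝ} (hr : 0 < r) :
    ∃ M > 0, ∀ N ≥ M, ∀ i, ∀ x ∈ gridCell a b N i, gridCell a b N i ⊆ Metric.ball x r := by
  obtain ⟨M, hM⟩ := exists_nat_gt (max ((b.1 - a.1) / r) ((b.2 - a.2) / r))
  have hM0 : (0 : ℝ) < M :=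
    (div_pos (sub_pos.2 h₁) hr).trans ((le_max_left _ _).trans_lt hM)
  refine ⟨M, by exact_mod_cast hM0, fun N hN i x hx y hy => ?_⟩
  have hMN : (M : ℝ) ≤ N := by exact_mod_cast hN
  have hN0 : (0 : ℝ) < N := hM0.trans_le hMN
  have l₁ : (b.1 - a.1) / N < r := by
    rw [div_lt_comm₀ hN0 hr]
    exact ((le_max_left _ _).trans_lt hM).trans_le hMN
  have l₂ : (b.2 - a.2) / N < r := by
    rw [div_lt_comm₀ hN0 hr]
    exact ((le_max_right _ _).trans_lt hM).trans_le hMN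
  rw [gridCell_eq_prod] at hx hy
  rw [Metric.mem_ball, Prod.dist_eq, max_lt_iff]
  constructor
  · refine (Real.dist_le_of_mem_Icc hy.1 hx.1).trans_lt ?_
    rwa [gridNode_succ_sub]
  · refine (Real.dist_le_of_mem_Icc hy.2 hx.2).trans_lt ?_
    rwa [gridNode_succ_sub]

theorem exists_isFineTagging (h₁ : a.1 < b.1) (h₂ : a.2 < b.2) {δ : ℝ × ℝ → ℝ}
    (hδ : IsGauge (Icc a b) δ) : ∃ N > 0, ∃ τ, IsFineTagging a b δ N τ := by
  obtain ⟨r, hr, H⟩ := lebesgue_number_lemma_of_metric (s := Icc a b)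
    (c := fun t : Icc a b => Metric.ball t.1 (δ t)) isCompact_Icc
    (fun _ => Metric.isOpen_ball)
    (fun x hx => mem_iUnion.2 ⟨⟨x, hx⟩, Metric.mem_ball_self (hδ x hx)⟩)
  obtain ⟨N, hN, hr⟩ := exists_gridCell_subset_ball h₁ hr
  have : ∀ i ∈ gridIndices N, ∃ t, t ∈ Icc a b ∧ gridCell a b N i ⊆ Metric.ball t (δ t) := by
    intro i hi
    have hp := gridPoint_mem_gridCell h₁ h₂ hN i
    obtain ⟨t, ht⟩ := H _ (gridCell_subset h₁ h₂ hN hi hp)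
    exact ⟨t, t.2, (hr N le_rfl i _ hp).trans ht⟩
  choose! τ hτ using this
  exact ⟨N, hN, τ, hτ⟩

theorem IsFineTagging.mono {δ δ' : ℝ × ℝ → ℝ} {τ : ℕ × ℕ → ℝ × ℝ}
    (hτ : IsFineTagging a b δ N τ) (h : δ ≤ δ') : IsFineTagging a b δ' N τ := fun i hi =>
  ⟨(hτ i hi).1, (hτ i hi).2.trans (Metric.ball_subset_ball (h _))⟩

theorem IsFineTagging.refine (h₁ : a.1 < b.1) (h₂ : a.2 < b.2) (hN : 0 < N)
    {δ : ℝ × ℝ → ℝ} {τ : ℕ × ℕ → ℝ × ℝ} (hτ : IsFineTagging a b δ N τ) {m : ℕ} (hm : 0 < m) :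
    IsFineTagging a b δ (N * m) (τ ∘ coarseIndex m) := fun i hi =>
  ⟨(hτ _ (coarseIndex_mem hi)).1,
    (gridCell_subset_gridCell_coarseIndex h₁ h₂ hN hm i).trans (hτ _ (coarseIndex_mem hi)).2⟩

theorem IsFineTagging.sum_lt (h₁ : a.1 < b.1) (h₂ : a.2 < b.2) (hN : 0 < N)
    {δ : ℝ × ℝ → ℝ} {τ : ℕ × ℕ → ℝ × ℝ} (hτ : IsFineTagging a b δ N τ)
    {f : ℝ × ℝ → X} {F : (ℝ × ℝ) × (ℝ × ℝ) → X} {ε : ℝ}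
    (H : ∀ P, IsMPartition (Icc a b) P → IsFine δ P →
      ∑ x ∈ P, ‖(volume (itemBox x)).toReal • f x.1 - F (x.2.1, x.2.2)‖ < ε) :
    ∑ i ∈ gridIndices N, ‖gridArea a b N • f (τ i) -
      F (gridPoint a b N i, gridPoint a b N (i + 1))‖ < ε := by
  set φ : ℕ × ℕ → (ℝ × ℝ) × (ℝ × ℝ) × (ℝ × ℝ) :=
    fun i => (τ i, gridPoint a b N i, gridPoint a b N (i + 1)) with hφ
  have hbox : ∀ i, itemBox (φ i) = gridCell a b N i := fun _ => rfl
  have hinj : Function.Injective φ := fun i j h =>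
    gridPoint_injective h₁ h₂ hN (congrArg (fun x => x.2.1) h)
  have hP : IsMPartition (Icc a b) ((gridIndices N).map ⟨φ, hinj⟩) := by
    refine ⟨?_, ?_, ?_⟩
    · intro x hx
      obtain ⟨i, hi, rfl⟩ := Finset.mem_map.1 hx
      refine ⟨(hτ i hi).1, gridCell_subset h₁ h₂ hN hi, ?_⟩
      change (interior (gridCell a b N i)).Nonempty
      rw [interior_gridCell]
      exact (nonempty_Ioo.2 (gridNode_strictMono h₁ hN (Nat.lt_succ_self _))).prod
        (nonempty_Ioo.2 (gridNode_strictMono h₂ hN (Nat.lt_succ_self _)))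
    · intro x hx y hy hxy
      obtain ⟨i, hi, rfl⟩ := Finset.mem_map.1 hx
      obtain ⟨j, hj, rfl⟩ := Finset.mem_map.1 hy
      exact interior_gridCell_inter h₁ h₂ hN fun h => hxy (by rw [h])
    · refine Subset.antisymm (iUnion₂_subset fun x hx => ?_) fun x hx => ?_
      · obtain ⟨i, hi, rfl⟩ := Finset.mem_map.1 hx
        exact gridCell_subset h₁ h₂ hN hi
      · obtain ⟨i, hi, h⟩ := mem_iUnion₂.1 (Icc_subset_iUnion_gridCell hN hx)
        exact mem_iUnion₂.2 ⟨φ i, Finset.mem_map.2 ⟨i, hi, rfl⟩, h⟩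
  have hfine : IsFine δ ((gridIndices N).map ⟨φ, hinj⟩) := by
    intro x hx
    obtain ⟨i, hi, rfl⟩ := Finset.mem_map.1 hx
    exact (hτ i hi).2
  have := H _ hP hfine
  rw [Finset.sum_map] at this
  simpa only [Function.Embedding.coeFn_mk, hbox, volume_gridCell h₁,
    ENNReal.toReal_ofReal (gridArea_pos h₁ h₂ hN).le] using this

theorem ae_ne_gridNode : ∀ᵐ x : ℝ × ℝ, ∀ i,
    x.1 ≠ gridNode a.1 b.1 N i ∧ x.2 ≠ gridNode a.2 b.2 N i := by
  have aux : ∀ c d : ℝ, ∀ᵐ y : ℝ, ∀ i, y ≠ gridNode c d N i := fun c d =>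
    ae_all_iff.2 fun i => by simp [ae_iff]
  filter_upwards [Measure.quasiMeasurePreserving_fst.ae (aux a.1 b.1),
    Measure.quasiMeasurePreserving_snd.ae (aux a.2 b.2)] with x h h' i
  exact ⟨h i, h' i⟩

theorem eventually_gridIndex_eq (h₁ : a.1 < b.1) (h₂ : a.2 < b.2) (hN : 0 < N) {x : ℝ × ℝ}
    (hx : a ≤ x) (hne : ∀ i, x.1 ≠ gridNode a.1 b.1 N i ∧ x.2 ≠ gridNode a.2 b.2 N i) :
    ∀ᶠ y in nhds x, gridIndex a b N y = gridIndex a b N x := by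
  have e₁ := continuousAt_fst.eventually
    (eventually_gridNodeIndex_eq h₁ hN hx.1 fun i => (hne i).1)
  have e₂ := continuousAt_snd.eventually
    (eventually_gridNodeIndex_eq h₂ hN hx.2 fun i => (hne i).2)
  filter_upwards [e₁, e₂] with y hy₁ hy₂
  exact Prod.ext hy₁ hy₂

theorem gridIndex_gridPoint (h₁ : a.1 < b.1) (h₂ : a.2 < b.2) (hN : 0 < N) {m : ℕ} (hm : 0 < m)
    (i : ℕ × ℕ) : gridIndex a b N (gridPoint a b (N * m) i) = coarseIndex m i :=
  Prod.ext (gridNodeIndex_gridNode h₁ hN hm _) (gridNodeIndex_gridNode h₂ hN hm _)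

theorem stronglyMeasurable_comp_gridIndex {Y : Type*} [TopologicalSpace Y] (u : ℕ × ℕ → Y) :
    StronglyMeasurable fun x => u (gridIndex a b N x) :=
  (StronglyMeasurable.of_discrete (f := u)).comp_measurable
    ((measurable_gridNodeIndex.comp measurable_fst).prodMk
      (measurable_gridNodeIndex.comp measurable_snd))

theorem setLIntegral_comp_gridIndex_le (h₁ : a.1 < b.1) (h₂ : a.2 < b.2) (hN : 0 < N)
    (u : ℕ × ℕ → ENNReal) :
    ∫⁻ x in Icc a b, u (gridIndex a b N x) ≤
      ∑ i ∈ gridIndices N, ENNReal.ofReal (gridArea a b N) * u i := by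
  calc ∫⁻ x in Icc a b, u (gridIndex a b N x)
      ≤ ∫⁻ x in ⋃ i ∈ gridIndices N, gridCell a b N i, u (gridIndex a b N x) :=
        lintegral_mono_set (Icc_subset_iUnion_gridCell hN)
    _ ≤ ∑ i ∈ gridIndices N, ∫⁻ x in gridCell a b N i, u (gridIndex a b N x) := by
        rw [lintegral_biUnion_finset₀]
        · intro i _ j _ hij
          exact aedisjoint_Icc_of_interior_inter_eq_empty
            (fun p q => (convex_Icc p q).addHaar_frontier volume)
            (interior_gridCell_inter h₁ h₂ hN hij)
        · exact fun i _ => isClosed_Icc.measurableSet.nullMeasurableSet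
    _ = ∑ i ∈ gridIndices N, ENNReal.ofReal (gridArea a b N) * u i := by
        refine Finset.sum_congr rfl fun i hi => ?_
        rw [setLIntegral_congr_fun_ae (s := gridCell a b N i) (g := fun _ => u i)
          isClosed_Icc.measurableSet,
          setLIntegral_const, volume_gridCell h₁, mul_comm]
        filter_upwards [ae_ne_gridNode (a := a) (b := b) (N := N)] with x hx hxi
        have hax := (gridCell_subset h₁ h₂ hN hi hxi).1
        rw [gridCell_eq_prod] at hxi
        congr 1
        refine Prod.ext ((gridNodeIndex_eq_iff h₁ hN hax.1 _).2
          ⟨hxi.1.1, lt_of_le_of_ne hxi.1.2 (hx _).1⟩)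
          ((gridNodeIndex_eq_iff h₂ hN hax.2 _).2
          ⟨hxi.2.1, lt_of_le_of_ne hxi.2.2 (hx _).2⟩)

theorem IsFineTagging.sum_norm_sub_lt (h₁ : a.1 < b.1) (h₂ : a.2 < b.2) (hN : 0 < N)
    {δ : ℝ × ℝ → ℝ} {τ σ : ℕ × ℕ → ℝ × ℝ} (hτ : IsFineTagging a b δ N τ)
    (hσ : IsFineTagging a b δ N σ) {f : ℝ × ℝ → X} {F : (ℝ × ℝ) × (ℝ × ℝ) → X} {ε : ℝ}
    (H : ∀ P, IsMPartition (Icc a b) P → IsFine δ P →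
      ∑ x ∈ P, ‖(volume (itemBox x)).toReal • f x.1 - F (x.2.1, x.2.2)‖ < ε) :
    ∑ i ∈ gridIndices N, gridArea a b N * ‖f (τ i) - f (σ i)‖ < 2 * ε := by
  have h := add_lt_add (hτ.sum_lt h₁ h₂ hN H) (hσ.sum_lt h₁ h₂ hN H)
  rw [← two_mul, ← Finset.sum_add_distrib] at h
  refine (Finset.sum_le_sum fun i _ => ?_).trans_lt h
  rw [← norm_smul_of_nonneg (gridArea_pos h₁ h₂ hN).le, smul_sub]
  refine le_of_eq_of_le ?_ (norm_sub_le _ _)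
  congr 1
  abel

/-- A strongly McShane integrable function is close in measure to the step functions given by
fine taggings of a grid. -/
theorem IsFineTagging.measure_le (h₁ : a.1 < b.1) (h₂ : a.2 < b.2) (hN : 0 < N)
    {δ : ℝ × ℝ → ℝ} (hδ : IsGauge (Icc a b) δ) {τ : ℕ × ℕ → ℝ × ℝ}
    (hτ : IsFineTagging a b δ N τ) {f : ℝ × ℝ → X} {F : (ℝ × ℝ) × (ℝ × ℝ) → X} {ε : ℝ}
    (H : ∀ P, IsMPartition (Icc a b) P → IsFine δ P →
      ∑ x ∈ P, ‖(volume (itemBox x)).toReal • f x.1 - F (x.2.1, x.2.2)‖ < ε)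
    {η : ℝ} (hη : 0 < η) :
    volume.restrict (Icc a b) {x | η ≤ ‖f x - f (τ (gridIndex a b N x))‖} ≤
      ENNReal.ofReal (2 * ε / η) := by
  classical
  set D : Set (ℝ × ℝ) := {x | x ∈ Icc a b ∧
    (∀ i, x.1 ≠ gridNode a.1 b.1 N i ∧ x.2 ≠ gridNode a.2 b.2 N i) ∧
    η ≤ ‖f x - f (τ (gridIndex a b N x))‖} with hD
  have hr : ∀ t ∈ D, ∃ r, 0 < r ∧ r ≤ δ t ∧
      ∀ y ∈ Metric.ball t r, gridIndex a b N y = gridIndex a b N t := by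
    rintro t ⟨ht, hne, -⟩
    obtain ⟨r, hr, h⟩ := Metric.eventually_nhds_iff_ball.1
      (eventually_gridIndex_eq h₁ h₂ hN ht.1 hne)
    exact ⟨min r (δ t), lt_min hr (hδ t ht), min_le_right _ _, fun y hy =>
      h y (Metric.ball_subset_ball (min_le_left _ _) hy)⟩
  choose! r hr0 hrδ hrc using hr
  set U : Set (ℝ × ℝ) := ⋃ t : D, Metric.ball t.1 (r t) with hU
  have hUo : IsOpen U := isOpen_iUnion fun _ => Metric.isOpen_ball
  have hDU : D ⊆ U := fun t ht => mem_iUnion.2 ⟨⟨t, ht⟩, Metric.mem_ball_self (hr0 t ht)⟩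
  have hμD : volume.restrict (Icc a b) {x | η ≤ ‖f x - f (τ (gridIndex a b N x))‖} ≤
      volume.restrict (Icc a b) U := by
    refine measure_mono_ae ?_
    filter_upwards [ae_restrict_of_ae (ae_ne_gridNode (a := a) (b := b) (N := N)),
      ae_restrict_mem isClosed_Icc.measurableSet] with x hx hxK hxη
    exact hDU ⟨hxK, hx, hxη⟩
  refine hμD.trans ?_
  have : IsFiniteMeasure (volume.restrict (Icc a b)) :=
    ⟨by simpa using isCompact_Icc.measure_lt_top⟩
  rw [hUo.measure_eq_iSup_isCompact]
  refine iSup₂_le fun C hCU => iSup_le fun hC => ?_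
  rw [Measure.restrict_apply hC.measurableSet]
  set C' := C ∩ Icc a b with hC'
  obtain ⟨s, hs, hsC⟩ := lebesgue_number_lemma_of_metric (s := C')
    (c := fun t : D => Metric.ball t.1 (r t)) (hC.inter isCompact_Icc)
    (fun _ => Metric.isOpen_ball) (inter_subset_left.trans hCU)
  obtain ⟨m, hm, hms⟩ := exists_gridCell_subset_ball h₁ hs
  have hNm : 0 < N * m := Nat.mul_pos hN hm
  set σ : ℕ × ℕ → ℝ × ℝ := fun i =>
    if h : ∃ t ∈ D, gridCell a b (N * m) i ⊆ Metric.ball t (r t) then h.choose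
    else τ (coarseIndex m i) with hσdef
  have hσD : ∀ i, (∃ t ∈ D, gridCell a b (N * m) i ⊆ Metric.ball t (r t)) →
      σ i ∈ D ∧ gridCell a b (N * m) i ⊆ Metric.ball (σ i) (r (σ i)) := by
    intro i h
    simp only [hσdef, dif_pos h]
    exact h.choose_spec
  have hσ : IsFineTagging a b δ (N * m) σ := by
    intro i hi
    by_cases h : ∃ t ∈ D, gridCell a b (N * m) i ⊆ Metric.ball t (r t)
    · obtain ⟨hD', hb⟩ := hσD i h
      exact ⟨hD'.1, hb.trans (Metric.ball_subset_ball (hrδ _ hD'))⟩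
    · simp only [hσdef, dif_neg h]
      exact hτ.refine h₁ h₂ hN hm i hi
  have hsum := hσ.sum_norm_sub_lt h₁ h₂ hNm (hτ.refine h₁ h₂ hN hm) H
  set S := (gridIndices (N * m)).filter fun i => (gridCell a b (N * m) i ∩ C').Nonempty with hS
  have hηS : ∀ i ∈ S, η ≤ ‖f (σ i) - f ((τ ∘ coarseIndex m) i)‖ := by
    intro i hi
    obtain ⟨hi, x, hxi, hxC⟩ := Finset.mem_filter.1 hi
    obtain ⟨t, ht⟩ := hsC x hxC
    obtain ⟨hD', hb⟩ := hσD i ⟨t, t.2, (hms (N * m) (Nat.le_mul_of_pos_left m hN) i x hxi).trans ht⟩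
    have := hrc _ hD' _ (hb (gridPoint_mem_gridCell h₁ h₂ hNm i))
    rw [gridIndex_gridPoint h₁ h₂ hN hm] at this
    rw [Function.comp_apply, this]
    exact hD'.2.2
  have hA := gridArea_pos h₁ h₂ hNm
  have hcard : S.card * gridArea a b (N * m) ≤ 2 * ε / η := by
    rw [le_div_iff₀ hη]
    refine le_trans ?_ hsum.le
    refine le_trans ?_ (Finset.sum_le_sum_of_subset_of_nonneg (s := S)
      (Finset.filter_subset _ _) fun i _ _ => mul_nonneg hA.le (norm_nonneg _))
    refine le_trans ?_ (Finset.card_nsmul_le_sum S _ (gridArea a b (N * m) * η) fun i hi =>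
      mul_le_mul_of_nonneg_left (hηS i hi) hA.le)
    rw [nsmul_eq_mul, mul_assoc]
  calc volume C' ≤ volume (⋃ i ∈ S, gridCell a b (N * m) i) := by
        refine measure_mono fun x hx => ?_
        obtain ⟨i, hi, hxi⟩ := mem_iUnion₂.1 (Icc_subset_iUnion_gridCell hNm hx.2)
        exact mem_iUnion₂.2 ⟨i, Finset.mem_filter.2 ⟨hi, x, hxi, hx⟩, hxi⟩
    _ ≤ ∑ i ∈ S, volume (gridCell a b (N * m) i) := measure_biUnion_finset_le _ _
    _ = ENNReal.ofReal (S.card * gridArea a b (N * m)) := by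
        simp only [volume_gridCell h₁, Finset.sum_const, nsmul_eq_mul]
        rw [ENNReal.ofReal_mul (Nat.cast_nonneg _), ENNReal.ofReal_natCast]
    _ ≤ ENNReal.ofReal (2 * ε / η) := ENNReal.ofReal_le_ofReal hcard

theorem IsFineTagging.exists_sum_norm_le (h₁ : a.1 < b.1) (h₂ : a.2 < b.2)
    {δ : ℝ × ℝ → ℝ} (hδ : IsGauge (Icc a b) δ)
    {f : ℝ × ℝ → X} {F : (ℝ × ℝ) × (ℝ × ℝ) → X} {ε : ℝ}
    (H : ∀ P, IsMPartition (Icc a b) P → IsFine δ P →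
      ∑ x ∈ P, ‖(volume (itemBox x)).toReal • f x.1 - F (x.2.1, x.2.2)‖ < ε) :
    ∃ B : ℝ, ∃ N₀ > 0, ∀ N > 0, ∀ τ, IsFineTagging a b δ (N * N₀) τ →
      ∑ i ∈ gridIndices (N * N₀), gridArea a b (N * N₀) * ‖f (τ i)‖ ≤ B := by
  obtain ⟨N₀, hN₀, σ, hσ⟩ := exists_isFineTagging h₁ h₂ hδ
  obtain ⟨M, hM⟩ : ∃ M : ℝ, ∀ i ∈ gridIndices N₀, ‖f (σ i)‖ ≤ M :=
    ⟨∑ i ∈ gridIndices N₀, ‖f (σ i)‖, fun i hi =>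
      Finset.single_le_sum (f := fun i => ‖f (σ i)‖) (fun _ _ => norm_nonneg _) hi⟩
  refine ⟨2 * ε + (b.1 - a.1) * (b.2 - a.2) * M, N₀, hN₀, fun N hN τ hτ => ?_⟩
  have hNN : 0 < N * N₀ := Nat.mul_pos hN hN₀
  have hA := gridArea_pos h₁ h₂ hNN
  have hσ' : IsFineTagging a b δ (N * N₀) (σ ∘ coarseIndex N) := by
    rw [mul_comm]
    exact hσ.refine h₁ h₂ hN₀ hN
  have h1 := hτ.sum_norm_sub_lt h₁ h₂ hNN hσ' H
  have h2 : ∑ i ∈ gridIndices (N * N₀), gridArea a b (N * N₀) * M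
      = (b.1 - a.1) * (b.2 - a.2) * M := by
    have : (N : ℝ) ≠ 0 := by positivity
    have : (N₀ : ℝ) ≠ 0 := by positivity
    rw [Finset.sum_const, nsmul_eq_mul]
    simp only [gridIndices, Finset.card_product, Finset.card_range, gridArea]
    push_cast
    field_simp
  rw [← h2]
  refine le_trans ?_ (add_le_add_left h1.le _)
  rw [← Finset.sum_add_distrib]
  refine Finset.sum_le_sum fun i hi => ?_
  rw [← mul_add]
  refine mul_le_mul_of_nonneg_left ?_ hA.le
  have h3 : ‖f ((σ ∘ coarseIndex N) i)‖ ≤ M :=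
    hM _ (coarseIndex_mem (by rwa [mul_comm] at hi))
  have h4 := norm_le_norm_sub_add (f (τ i)) (f ((σ ∘ coarseIndex N) i))
  linarith

/-- A strongly McShane integrable function on a plane interval is Bochner integrable. -/
theorem HasStrongMcShaneIntegral.integrableOn (h₁ : a.1 < b.1) (h₂ : a.2 < b.2)
    {f : ℝ × ℝ → X} {v : X} (hf : HasStrongMcShaneIntegral a b f v) :
    IntegrableOn f (Icc a b) := by
  obtain ⟨F, -, -, hF⟩ := hf
  obtain ⟨δ₀, hδ₀, H₀⟩ := hF 1 one_pos
  obtain ⟨B, N₀, hN₀, hB⟩ := IsFineTagging.exists_sum_norm_le h₁ h₂ hδ₀ H₀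
  have step : ∀ n : ℕ, ∃ N > 0, ∃ τ : ℕ × ℕ → ℝ × ℝ,
      (∑ i ∈ gridIndices N, gridArea a b N * ‖f (τ i)‖ ≤ B) ∧ ∀ η : ℝ, 0 < η →
      volume.restrict (Icc a b) {x | η ≤ ‖f x - f (τ (gridIndex a b N x))‖} ≤
        ENNReal.ofReal (2 * (1 / ((n : ℝ) + 1)) / η) := by
    intro n
    obtain ⟨δ, hδ, H⟩ := hF (1 / ((n : ℝ) + 1)) (by positivity)
    obtain ⟨N, hN, τ, hτ⟩ := exists_isFineTagging (δ := fun t => min (δ t) (δ₀ t)) h₁ h₂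
      fun t ht => lt_min (hδ t ht) (hδ₀ t ht)
    have hτ' := hτ.refine h₁ h₂ hN hN₀
    exact ⟨N * N₀, Nat.mul_pos hN hN₀, _,
      hB N hN _ (hτ'.mono fun t => min_le_right _ _), fun η hη =>
        (hτ'.mono fun t => min_le_left _ _).measure_le h₁ h₂ (Nat.mul_pos hN hN₀) hδ H hη⟩
  choose N hN τ hτB hτ using step
  have hmeas : ∀ n, AEStronglyMeasurable (fun x => f (τ n (gridIndex a b (N n) x)))
      (volume.restrict (Icc a b)) := fun n =>
    (stronglyMeasurable_comp_gridIndex fun i => f (τ n i)).aestronglyMeasurable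
  have hlim : TendstoInMeasure (volume.restrict (Icc a b))
      (fun n x => f (τ n (gridIndex a b (N n) x))) Filter.atTop f := by
    rw [tendstoInMeasure_iff_norm]
    intro η hη
    have h0 : Filter.Tendsto (fun n : ℕ => ENNReal.ofReal (2 * (1 / ((n : ℝ) + 1)) / η))
        Filter.atTop (nhds 0) := by
      have := ((tendsto_one_div_add_atTop_nhds_zero_nat (𝕜 := ℝ)).const_mul 2).div_const η
      simpa using ENNReal.tendsto_ofReal this
    refine tendsto_of_tendsto_of_tendsto_of_le_of_le tendsto_const_nhds h0
      (fun _ => zero_le) fun n => ?_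
    simpa only [norm_sub_rev] using hτ n η hη
  have hbound : ∀ n, eLpNorm (fun x => f (τ n (gridIndex a b (N n) x))) 1
      (volume.restrict (Icc a b)) ≤ ENNReal.ofReal B := by
    intro n
    rw [eLpNorm_one_eq_lintegral_enorm]
    refine (setLIntegral_comp_gridIndex_le h₁ h₂ (hN n) fun i => ‖f (τ n i)‖ₑ).trans ?_
    refine le_of_eq_of_le ?_ (ENNReal.ofReal_le_ofReal (hτB n))
    have hA := (gridArea_pos h₁ h₂ (hN n)).le
    rw [ENNReal.ofReal_sum_of_nonneg fun i _ => mul_nonneg hA (norm_nonneg _)]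
    simp only [ENNReal.ofReal_mul hA, ofReal_norm]
  rw [IntegrableOn, ← memLp_one_iff_integrable]
  exact ⟨hlim.aestronglyMeasurable hmeas,
    (eLpNorm_le_of_tendstoInMeasure (.of_forall hbound) hlim hmeas).trans_lt
      ENNReal.ofReal_lt_top⟩

end TwoDimensional

/-- Theorem 2.1(i): `f₀ = f·𝟙_{[a,b]∖Z}` is strongly integrable
and all of its sections are strongly integrable. -/
theorem fubini_main_mcShane_integrable {X : Type*} [NormedAddCommGroup X] [NormedSpace ℝ X] [CompleteSpace X] (a₁ b₁ a₂ b₂ : ℝ) (hab₁ : a₁ < b₁) (hab₂ : a₂ < b₂)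
    (f : ℝ × ℝ → X) (v : X)
    (hf : HasStrongMcShaneIntegral ((a₁, a₂) : ℝ × ℝ) (b₁, b₂) f v)
    (Z₁ : Set ℝ) (hZ₁ : Z₁ = {t₁ : ℝ | t₁ ∈ Set.Icc a₁ b₁ ∧ ¬ ∃ u : X, HasStrongMcShaneIntegral a₂ b₂ (fun s₂ => f (t₁, s₂)) u})
    (Z₂ : Set ℝ) (hZ₂ : Z₂ = {t₂ : ℝ | t₂ ∈ Set.Icc a₂ b₂ ∧ ¬ ∃ u : X, HasStrongMcShaneIntegral a₁ b₁ (fun s₁ => f (s₁, t₂)) u})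
    (Z : Set (ℝ × ℝ)) (hZ : Z = (Z₁ ×ˢ Set.Icc a₂ b₂) ∪ ((Set.Icc a₁ b₁) ×ˢ Z₂))
    (f₀ : ℝ × ℝ → X) (hf₀ : f₀ = ((Set.Icc ((a₁, a₂) : ℝ × ℝ) (b₁, b₂)) \ Z).indicator f) :
    (∃ v₀ : X, HasStrongMcShaneIntegral ((a₁, a₂) : ℝ × ℝ) (b₁, b₂) f₀ v₀) ∧
    (∀ t₁ ∈ Set.Icc a₁ b₁, ∃ u : X, HasStrongMcShaneIntegral a₂ b₂ (fun s₂ => f₀ (t₁, s₂)) u) ∧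
    (∀ t₂ ∈ Set.Icc a₂ b₂, ∃ u : X, HasStrongMcShaneIntegral a₁ b₁ (fun s₁ => f₀ (s₁, t₂)) u) := by
  have hnull : ∀ p q : ℝ, volume (frontier (Icc p q)) = 0 := fun p q =>
    (convex_Icc p q).addHaar_frontier volume
  have hfK := hf.integrableOn hab₁ hab₂
  have hprod : Integrable f
      ((volume.restrict (Icc a₁ b₁)).prod (volume.restrict (Icc a₂ b₂))) := by
    rwa [Measure.prod_restrict, ← Measure.volume_eq_prod, Icc_prod_Icc]
  have hZ₁0 : ∀ᵐ t₁ ∂volume.restrict (Icc a₁ b₁), t₁ ∉ Z₁ := by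
    filter_upwards [hprod.prod_right_ae] with t₁ ht h
    rw [hZ₁] at h
    exact h.2 ⟨_, hasStrongMcShaneIntegral_of_integrableOn hnull ht⟩
  have hZ₂0 : ∀ᵐ t₂ ∂volume.restrict (Icc a₂ b₂), t₂ ∉ Z₂ := by
    filter_upwards [hprod.prod_left_ae] with t₂ ht h
    rw [hZ₂] at h
    exact h.2 ⟨_, hasStrongMcShaneIntegral_of_integrableOn hnull ht⟩
  have hf₀_eq : ∀ t₁ ∈ Icc a₁ b₁, ∀ t₂ ∈ Icc a₂ b₂, t₁ ∉ Z₁ → t₂ ∉ Z₂ →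
      f₀ (t₁, t₂) = f (t₁, t₂) := by
    intro t₁ h₁ t₂ h₂ h₁' h₂'
    rw [hf₀, indicator_of_mem]
    refine ⟨⟨⟨h₁.1, h₂.1⟩, ⟨h₁.2, h₂.2⟩⟩, ?_⟩
    rw [hZ]
    rintro (h | h)
    exacts [h₁' h.1, h₂' h.2]
  have hf₀_zero₁ : ∀ t₁ ∈ Icc a₁ b₁, ∀ t₂ ∈ Icc a₂ b₂, t₁ ∈ Z₁ → f₀ (t₁, t₂) = 0 := by
    intro t₁ h₁ t₂ h₂ h
    rw [hf₀, indicator_of_notMem]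
    rw [hZ]
    exact fun h' => h'.2 (Or.inl ⟨h, h₂⟩)
  have hf₀_zero₂ : ∀ t₁ ∈ Icc a₁ b₁, ∀ t₂ ∈ Icc a₂ b₂, t₂ ∈ Z₂ → f₀ (t₁, t₂) = 0 := by
    intro t₁ h₁ t₂ h₂ h
    rw [hf₀, indicator_of_notMem]
    rw [hZ]
    exact fun h' => h'.2 (Or.inr ⟨h₁, h⟩)
  refine ⟨⟨_, hasStrongMcShaneIntegral_of_integrableOn
    (fun p q => (convex_Icc p q).addHaar_frontier volume) (hfK.congr_fun_ae ?_)⟩, ?_, ?_⟩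
  · have hZ0 : ∀ᵐ x ∂(volume.restrict (Icc a₁ b₁)).prod (volume.restrict (Icc a₂ b₂)),
        x.1 ∉ Z₁ ∧ x.2 ∉ Z₂ :=
      (Measure.quasiMeasurePreserving_fst.ae hZ₁0).and (Measure.quasiMeasurePreserving_snd.ae hZ₂0)
    rw [Measure.prod_restrict, ← Measure.volume_eq_prod, Icc_prod_Icc] at hZ0
    filter_upwards [hZ0, ae_restrict_mem isClosed_Icc.measurableSet] with x hx hxK
    exact (hf₀_eq _ ⟨hxK.1.1, hxK.2.1⟩ _ ⟨hxK.1.2, hxK.2.2⟩ hx.1 hx.2).symm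
  · intro t₁ ht₁
    by_cases h : t₁ ∈ Z₁
    · exact ⟨_, (hasStrongMcShaneIntegral_of_integrableOn hnull integrableOn_zero).congr
        fun t₂ ht₂ => (hf₀_zero₁ t₁ ht₁ t₂ ht₂ h).symm⟩
    · obtain ⟨u, hu⟩ : ∃ u, HasStrongMcShaneIntegral a₂ b₂ (fun s₂ => f (t₁, s₂)) u := by
        by_contra hc
        exact h (hZ₁ ▸ ⟨ht₁, hc⟩)
      refine hu.exists_of_ae_eq hnull ?_
      filter_upwards [hZ₂0, ae_restrict_mem isClosed_Icc.measurableSet] with t₂ ht₂ ht₂'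
      exact (hf₀_eq t₁ ht₁ t₂ ht₂' h ht₂).symm
  · intro t₂ ht₂
    by_cases h : t₂ ∈ Z₂
    · exact ⟨_, (hasStrongMcShaneIntegral_of_integrableOn hnull integrableOn_zero).congr
        fun t₁ ht₁ => (hf₀_zero₂ t₁ ht₁ t₂ ht₂ h).symm⟩
    · obtain ⟨u, hu⟩ : ∃ u, HasStrongMcShaneIntegral a₁ b₁ (fun s₁ => f (s₁, t₂)) u := by
        by_contra hc
        exact h (hZ₂ ▸ ⟨ht₂, hc⟩)
      refine hu.exists_of_ae_eq hnull ?_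
      filter_upwards [hZ₁0, ae_restrict_mem isClosed_Icc.measurableSet] with t₁ ht₁ ht₁'
      exact (hf₀_eq t₁ ht₁' t₂ ht₂ ht₁ h).symm
end

section
/- Let f : [a,b] → X be strongly McShane integrable on [a,b], let Z₁ = { t₁ ∈ [a₁,b₁] : the section f_{t₁} is not strongly McShane integrable on [a₂,b₂] }, Z₂ = { t₂ ∈ [a₂,b₂] : the section f_{t₂} is not strongly McShane integrable on [a₁,b₁] }, Z = (Z₁ × [a₂,b₂]) ∪ ([a₁,b₁] × Z₂), and f₀ = f·𝟙_{[a,b]∖Z}. Then the function h(t₂) = (M)∫_{[a₁,b₁]} (f₀)_{t₂}, t₂ ∈ [a₂,b₂], is strongly McShane integrable on [a₂,b₂] and (M)∫_{[a₂,b₂]} ((M)∫_{[a₁,b₁]} (f₀)_{t₂}) = (M)∫_{[a,b]} f. -/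
open Set MeasureTheory

variable {E : Type*} [MeasureSpace E] [PseudoMetricSpace E] [Preorder E]
variable {X : Type*} [NormedAddCommGroup X] [NormedSpace ℝ X]

section Generic

set_option linter.unusedSectionVars false

open Filter Topology
open scoped ENNReal

theorem aedisjoint_Icc {E : Type*} [MeasureSpace E] [TopologicalSpace E] [Preorder E]
    [OrderClosedTopology E] (hfr : ∀ p q : E, volume (frontier (Icc p q)) = 0) {p q r s : E}
    (h : interior (Icc p q) ∩ interior (Icc r s) = ∅) :
    AEDisjoint volume (Icc p q) (Icc r s) := by
  refine measure_mono_null (t := frontier (Icc p q) ∪ frontier (Icc r s)) ?_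
    (measure_union_null (hfr _ _) (hfr _ _))
  rintro x ⟨h1, h2⟩
  rw [isClosed_Icc.frontier_eq, isClosed_Icc.frontier_eq]
  by_cases h3 : x ∈ interior (Icc p q)
  · exact Or.inr ⟨h2, fun h4 => h.subset ⟨h3, h4⟩⟩
  · exact Or.inl ⟨h1, h3⟩

variable {E : Type*} [MeasureSpace E] [PseudoMetricSpace E] [BorelSpace E] [ProperSpace E]
  [IsLocallyFiniteMeasure (volume : Measure E)]

/-- An integrable function oscillates around each point by at most a dominating function of
small integral, on a ball depending on the point. -/
theorem MeasureTheory.Integrable.exists_gauge_enorm_sub_le {f : E → X} (hf : Integrable f)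
    {K : Set E} (hK : volume K ≠ ∞) {ε : ℝ≥0∞} (hε : ε ≠ 0) :
    ∃ (δ : E → ℝ) (W : E → ℝ≥0∞), (∀ t, 0 < δ t) ∧ ∫⁻ s in K, W s ≤ ε ∧
      ∀ t, ∀ s ∈ Metric.ball t (δ t), ‖f t - f s‖ₑ ≤ W s := by
  have h4 : ε / 4 ≠ 0 := by simp [hε]
  obtain ⟨g, hgs, hfg, hgc, hgi⟩ := hf.exists_hasCompactSupport_lintegral_sub_le h4
  obtain ⟨U, hU, hUlsc, hUint⟩ := exists_lt_lowerSemicontinuous_lintegral_ge_of_aemeasurable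
    volume (fun x => ‖f x - g x‖₊) (hf.sub hgi).1.nnnorm.aemeasurable h4
  obtain ⟨c, hc0, hcK⟩ : ∃ c : ℝ, 0 < c ∧ ENNReal.ofReal c * volume K ≤ ε / 4 := by
    rcases eq_or_ne (volume K) 0 with h0 | h0
    · exact ⟨1, one_pos, by simp [h0]⟩
    obtain ⟨c, hc0, hc⟩ := ENNReal.lt_iff_exists_nnreal_btwn.1 (ENNReal.div_pos h4 hK)
    refine ⟨c, by exact_mod_cast hc0, ?_⟩
    rw [ENNReal.ofReal_coe_nnreal]
    exact (ENNReal.le_div_iff_mul_le (Or.inl h0) (Or.inl hK)).1 hc.le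
  obtain ⟨r, hr0, hr⟩ := Metric.uniformContinuous_iff.1
    (hgs.uniformContinuous_of_continuous hgc) c hc0
  have hρ : ∀ t, ∃ ρ > 0, ∀ s ∈ Metric.ball t ρ, (‖f t - g t‖₊ : ℝ≥0∞) < U s := fun t =>
    Metric.eventually_nhds_iff_ball.1 (hUlsc t _ (hU t))
  choose ρ hρ0 hρ using hρ
  refine ⟨fun t => min r (ρ t), fun s => U s + ENNReal.ofReal c + ‖f s - g s‖ₑ,
    fun t => lt_min hr0 (hρ0 t), ?_, ?_⟩
  · have hm : AEMeasurable (fun s => ‖f s - g s‖ₑ) (volume.restrict K) :=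
      (hf.sub hgi).1.restrict.enorm
    rw [lintegral_add_right' _ hm,
      lintegral_add_right _ measurable_const, lintegral_const, Measure.restrict_apply_univ]
    have hfg' : ∫⁻ s in K, ‖f s - g s‖ₑ ≤ ε / 4 := (setLIntegral_le_lintegral _ _).trans hfg
    have hU' : ∫⁻ s in K, U s ≤ ε / 4 + ε / 4 :=
      (setLIntegral_le_lintegral _ _).trans (hUint.trans (by gcongr; exact hfg))
    calc _ ≤ ε / 4 + ε / 4 + ε / 4 + ε / 4 := by gcongr
      _ = ε / 4 * 4 := by ring
      _ = ε := ENNReal.div_mul_cancel (by simp) (by simp)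
  · intro t s hs
    have h1 := hρ t s (Metric.ball_subset_ball (min_le_right _ _) hs)
    have h2 : dist (g s) (g t) < c := hr (Metric.ball_subset_ball (min_le_left _ _) hs)
    have h2' : ‖g t - g s‖ₑ ≤ ENNReal.ofReal c := by
      rw [← ofReal_norm, ← dist_eq_norm, dist_comm]
      exact ENNReal.ofReal_le_ofReal h2.le
    calc ‖f t - f s‖ₑ = ‖(f t - g t) + (g t - g s) + -(f s - g s)‖ₑ := by congr 1; abel
      _ ≤ ‖f t - g t‖ₑ + ‖g t - g s‖ₑ + ‖-(f s - g s)‖ₑ :=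
        (enorm_add_le _ _).trans (by gcongr; exact enorm_add_le _ _)
      _ ≤ _ := by
        rw [enorm_neg]
        exact add_le_add (add_le_add h1.le h2') le_rfl

variable [Preorder E] [CompactIccSpace E] [OrderClosedTopology E]

/-- The integral as an interval function approximates Riemann sums strongly. -/
theorem MeasureTheory.IntegrableOn.exists_gauge [CompleteSpace X]
    (hfr : ∀ p q : E, volume (frontier (Icc p q)) = 0) {a b : E} {f : E → X}
    (hf : IntegrableOn f (Icc a b)) {ε : ℝ} (hε : 0 < ε) :
    ∃ δ : E → ℝ, (∀ t, 0 < δ t) ∧ ∀ P : Finset (E × E × E), IsMPartition (Icc a b) P →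
      IsFine δ P →
      ∑ x ∈ P, ‖(volume (itemBox x)).toReal • f x.1 - ∫ s in itemBox x, f s‖ < ε := by
  have hKm : MeasurableSet (Icc a b) := isClosed_Icc.measurableSet
  obtain ⟨δ, W, hδ, hW, hfW⟩ := (hf.integrable_indicator hKm).exists_gauge_enorm_sub_le
    (isCompact_Icc (a := a) (b := b)).measure_lt_top.ne
    (ε := ENNReal.ofReal (ε / 2)) (by simpa using hε)
  refine ⟨δ, hδ, fun P hP hfine => ?_⟩
  have hitem : ∀ x ∈ P, ‖(volume (itemBox x)).toReal • f x.1 - ∫ s in itemBox x, f s‖ₑ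
      ≤ ∫⁻ s in itemBox x, W s := by
    intro x hx
    have hsub : itemBox x ⊆ Icc a b := (hP.1 x hx).2.1
    have hm : MeasurableSet (itemBox x) := isClosed_Icc.measurableSet
    have hfin : volume (itemBox x) ≠ ∞ :=
      (isCompact_Icc (a := x.2.1) (b := x.2.2)).measure_lt_top.ne
    have heq : (volume (itemBox x)).toReal • f x.1 - ∫ s in itemBox x, f s
        = ∫ s in itemBox x, (f x.1 - f s) := by
      have hc : IntegrableOn (fun _ => f x.1) (itemBox x) := integrableOn_const hfin
      rw [integral_sub hc (hf.mono_set hsub), setIntegral_const]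
      rfl
    rw [heq]
    refine (enorm_integral_le_lintegral_enorm _).trans (setLIntegral_mono' hm fun s hs => ?_)
    have := hfW x.1 s (hfine x hx hs)
    rwa [indicator_of_mem (hP.1 x hx).1, indicator_of_mem (hsub hs)] at this
  have hsum : ∑ x ∈ P, ∫⁻ s in itemBox x, W s = ∫⁻ s in Icc a b, W s := by
    rw [← hP.2.2, lintegral_biUnion_finset₀ (t := itemBox)
      (fun x hx y hy hxy => aedisjoint_Icc hfr (hP.2.1 x hx y hy hxy))
      (fun x _ => isClosed_Icc.measurableSet.nullMeasurableSet)]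
  have hle : ENNReal.ofReal
      (∑ x ∈ P, ‖(volume (itemBox x)).toReal • f x.1 - ∫ s in itemBox x, f s‖)
        ≤ ENNReal.ofReal (ε / 2) := by
    rw [ENNReal.ofReal_sum_of_nonneg fun _ _ => norm_nonneg _]
    simp_rw [ofReal_norm]
    exact (Finset.sum_le_sum hitem).trans (hsum.trans_le hW)
  have := (ENNReal.ofReal_le_ofReal_iff (by positivity)).1 hle
  linarith

theorem MeasureTheory.IntegrableOn.isAdditiveIntervalFun
    (hfr : ∀ p q : E, volume (frontier (Icc p q)) = 0) {a b : E} {f : E → X}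
    (hf : IntegrableOn f (Icc a b)) :
    IsAdditiveIntervalFun (Icc a b) fun J : E × E => ∫ s in Icc J.1 J.2, f s := by
  intro p q r s u w hpq hrs _ hd hU
  simp only
  rw [← hU]
  exact setIntegral_union₀ (aedisjoint_Icc hfr hd)
    isClosed_Icc.measurableSet.nullMeasurableSet (hf.mono_set hpq.1) (hf.mono_set hrs.1)

theorem MeasureTheory.IntegrableOn.hasStrongMcShaneIntegral [CompleteSpace X]
    (hfr : ∀ p q : E, volume (frontier (Icc p q)) = 0) {a b : E} {f : E → X}
    (hf : IntegrableOn f (Icc a b)) :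
    HasStrongMcShaneIntegral a b f (∫ s in Icc a b, f s) := by
  refine ⟨_, hf.isAdditiveIntervalFun hfr, rfl, fun ε hε => ?_⟩
  obtain ⟨δ, hδ, h⟩ := hf.exists_gauge hfr hε
  exact ⟨δ, fun t _ => hδ t, h⟩

/-- A sequence of finite subdivisions of `[a, b]` into non-overlapping intervals, each refining
the previous ones, with mesh tending to zero. -/
structure IsGridSeq (a b : E) (G : ℕ → Finset (E × E)) : Prop where
  isSubinterval : ∀ n, ∀ J ∈ G n, IsSubinterval (Icc a b) J.1 J.2
  inter_eq : ∀ n, ∀ I ∈ G n, ∀ J ∈ G n, I ≠ J →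
    interior (Icc I.1 I.2) ∩ interior (Icc J.1 J.2) = ∅
  iUnion_eq : ∀ n, ⋃ J ∈ G n, Icc J.1 J.2 = Icc a b
  nested : ∀ m n, m ≤ n → ∀ J ∈ G n, ∃ I ∈ G m, Icc J.1 J.2 ⊆ Icc I.1 I.2
  mesh : ∀ r > 0, ∃ N, ∀ n ≥ N, ∀ J ∈ G n, ∀ x ∈ Icc J.1 J.2, Icc J.1 J.2 ⊆ Metric.ball x r

/-- The step function with value `c J` on the interior of each `J ∈ S`. -/
noncomputable def stepFun (S : Finset (E × E)) (c : E × E → X) (s : E) : X :=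
  ∑ J ∈ S, (interior (Icc J.1 J.2)).indicator (fun _ => c J) s

namespace IsGridSeq

variable {a b : E} {G : ℕ → Finset (E × E)}

theorem stepFun_eq (hG : IsGridSeq a b G) {n : ℕ} (c : E × E → X) {J : E × E} (hJ : J ∈ G n)
    {s : E} (hs : s ∈ interior (Icc J.1 J.2)) : stepFun (G n) c s = c J := by
  rw [stepFun, Finset.sum_eq_single_of_mem J hJ, indicator_of_mem hs]
  intro I hI hIJ
  exact indicator_of_notMem (fun h => (hG.inter_eq n I hI J hJ hIJ).subset ⟨h, hs⟩) _

theorem isMPartition (hG : IsGridSeq a b G) {n : ℕ} {τ : E × E → E}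
    (hτ : ∀ J ∈ G n, τ J ∈ Icc a b) [DecidableEq (E × E × E)] :
    IsMPartition (Icc a b) ((G n).image fun J => (τ J, J.1, J.2)) := by
  refine ⟨?_, ?_, ?_⟩
  · simp only [Finset.forall_mem_image]
    exact fun J hJ => ⟨hτ J hJ, hG.isSubinterval n J hJ⟩
  · simp only [Finset.forall_mem_image]
    exact fun I hI J hJ hIJ => hG.inter_eq n I hI J hJ fun h => hIJ (h ▸ rfl)
  · rw [← hG.iUnion_eq n, Finset.set_biUnion_finset_image]
    rfl

/-- A bound over all fine partitions applies to suitable taggings of a grid. -/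
theorem sum_lt (hG : IsGridSeq a b G) {n : ℕ} {τ : E × E → E} {δ : E → ℝ}
    {φ : E × E × E → ℝ} {ε : ℝ}
    (h : ∀ P, IsMPartition (Icc a b) P → IsFine δ P → ∑ x ∈ P, φ x < ε)
    (hτ : ∀ J ∈ G n, τ J ∈ Icc a b)
    (hδ : ∀ J ∈ G n, Icc J.1 J.2 ⊆ Metric.ball (τ J) (δ (τ J))) :
    ∑ J ∈ G n, φ (τ J, J.1, J.2) < ε := by
  classical
  have := h _ (hG.isMPartition hτ) (Finset.forall_mem_image.2 hδ)
  rwa [Finset.sum_image] at this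
  intro I _ J _ hIJ
  simp only [Prod.mk.injEq] at hIJ
  exact Prod.ext hIJ.2.1 hIJ.2.2

/-- Sufficiently fine grids can be tagged to be fine for a given gauge. -/
theorem exists_tag (hG : IsGridSeq a b G) {δ : E → ℝ} (hδ : IsGauge (Icc a b) δ) :
    ∃ N, ∀ n ≥ N, ∀ J ∈ G n, ∃ t ∈ Icc a b, Icc J.1 J.2 ⊆ Metric.ball t (δ t) := by
  obtain ⟨r, hr, hball⟩ := lebesgue_number_lemma_of_metric (isCompact_Icc (a := a) (b := b))
    (c := fun t : Icc a b => Metric.ball (t : E) (δ t)) (fun _ => Metric.isOpen_ball)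
    (fun t ht => mem_iUnion.2 ⟨⟨t, ht⟩, Metric.mem_ball_self (hδ t ht)⟩)
  obtain ⟨N, hN⟩ := hG.mesh r hr
  refine ⟨N, fun n hn J hJ => ?_⟩
  obtain ⟨x, hx⟩ := (hG.isSubinterval n J hJ).2
  have hx' := interior_subset hx
  obtain ⟨t, ht⟩ := hball x ((hG.isSubinterval n J hJ).1 hx')
  exact ⟨t, t.2, (hN n hn J hJ x hx').trans ht⟩

theorem sum_setLIntegral (hG : IsGridSeq a b G)
    (hfr : ∀ p q : E, volume (frontier (Icc p q)) = 0) (n : ℕ) (u : E → ℝ≥0∞) :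
    ∑ J ∈ G n, ∫⁻ s in Icc J.1 J.2, u s = ∫⁻ s in Icc a b, u s := by
  rw [← hG.iUnion_eq n, lintegral_biUnion_finset₀ (t := fun J : E × E => Icc J.1 J.2)
    (fun I hI J hJ hIJ => aedisjoint_Icc hfr (hG.inter_eq n I hI J hJ hIJ))
    (fun _ _ => isClosed_Icc.measurableSet.nullMeasurableSet)]

theorem setLIntegral_stepFun_sub (hG : IsGridSeq a b G)
    (hfr : ∀ p q : E, volume (frontier (Icc p q)) = 0) {m n : ℕ} {c d : E × E → X}
    {I J : E × E} (hI : I ∈ G m) (hJ : J ∈ G n) (hJI : Icc J.1 J.2 ⊆ Icc I.1 I.2) :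
    ∫⁻ s in Icc J.1 J.2, ‖stepFun (G n) c s - stepFun (G m) d s‖ₑ
      = ‖(volume (Icc J.1 J.2)).toReal • (c J - d I)‖ₑ := by
  rw [← setLIntegral_congr (interior_ae_eq_of_null_frontier (hfr J.1 J.2)),
    setLIntegral_congr_fun isOpen_interior.measurableSet (g := fun _ => ‖c J - d I‖ₑ),
    setLIntegral_const, measure_congr (interior_ae_eq_of_null_frontier (hfr J.1 J.2)),
    enorm_smul, Real.enorm_eq_ofReal ENNReal.toReal_nonneg,
    ENNReal.ofReal_toReal isCompact_Icc.measure_lt_top.ne, mul_comm]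
  intro s hs
  simp only [hG.stepFun_eq c hJ hs, hG.stepFun_eq d hI (interior_mono hJI hs)]

end IsGridSeq

theorem integrable_stepFun (S : Finset (E × E)) (c : E × E → X) : Integrable (stepFun S c) := by
  refine integrable_finsetSum _ fun J _ => ?_
  rw [integrable_indicator_iff isOpen_interior.measurableSet]
  exact integrableOn_const
    ((measure_mono interior_subset).trans_lt isCompact_Icc.measure_lt_top).ne

section StrongToBochner

variable [(volume : Measure E).IsOpenPosMeasure] {a b : E} {G : ℕ → Finset (E × E)}
  {f : E → X} {F : E × E → X}

/-- The average of `F` over a box. -/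
noncomputable def boxAverage (F : E × E → X) (J : E × E) : X :=
  (volume (Icc J.1 J.2)).toReal⁻¹ • F J

theorem IsGridSeq.volume_toReal_pos (hG : IsGridSeq a b G) {n : ℕ} {J : E × E} (hJ : J ∈ G n) :
    0 < (volume (Icc J.1 J.2)).toReal :=
  ENNReal.toReal_pos
    (Measure.measure_pos_of_nonempty_interior volume (hG.isSubinterval n J hJ).2).ne'
    isCompact_Icc.measure_lt_top.ne

theorem IsGridSeq.setLIntegral_stepFun_boxAverage_le (hG : IsGridSeq a b G)
    (hfr : ∀ p q : E, volume (frontier (Icc p q)) = 0) {ε : ℝ} {δ : E → ℝ}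
    (hδ : ∀ P, IsMPartition (Icc a b) P → IsFine δ P →
      ∑ x ∈ P, ‖(volume (itemBox x)).toReal • f x.1 - F (x.2.1, x.2.2)‖ < ε)
    {m n : ℕ} (hmn : m ≤ n) {τ : E × E → E} (hτ : ∀ J ∈ G m, τ J ∈ Icc a b)
    (hτδ : ∀ J ∈ G m, Icc J.1 J.2 ⊆ Metric.ball (τ J) (δ (τ J))) :
    ∫⁻ s in Icc a b, ‖stepFun (G n) (boxAverage F) s - stepFun (G m) (fun J => f (τ J)) s‖ₑ
      ≤ ENNReal.ofReal ε := by
  have : Nonempty E := ⟨a⟩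
  choose! π hπ hπsub using hG.nested m n hmn
  have hsum := hG.sum_lt hδ (τ := fun J => τ (π J)) (n := n) (fun J hJ => hτ _ (hπ J hJ))
    (fun J hJ => (hπsub J hJ).trans (hτδ _ (hπ J hJ)))
  rw [← hG.sum_setLIntegral hfr n]
  refine le_trans (le_of_eq ?_) (ENNReal.ofReal_le_ofReal hsum.le)
  rw [ENNReal.ofReal_sum_of_nonneg fun _ _ => norm_nonneg _]
  refine Finset.sum_congr rfl fun J hJ => ?_
  rw [hG.setLIntegral_stepFun_sub hfr (hπ J hJ) hJ (hπsub J hJ), ofReal_norm, smul_sub,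
    boxAverage, smul_inv_smul₀ (hG.volume_toReal_pos hJ).ne', ← enorm_neg, neg_sub]
  rfl

theorem IsGridSeq.exists_limit [CompleteSpace X] (hG : IsGridSeq a b G)
    (hfr : ∀ p q : E, volume (frontier (Icc p q)) = 0)
    (hF : ∀ ε > 0, ∃ δ : E → ℝ, IsGauge (Icc a b) δ ∧
      ∀ P, IsMPartition (Icc a b) P → IsFine δ P →
        ∑ x ∈ P, ‖(volume (itemBox x)).toReal • f x.1 - F (x.2.1, x.2.2)‖ < ε) :
    ∃ g : E → X, IntegrableOn g (Icc a b) ∧ ∀ ε > 0, ∃ N, ∀ n ≥ N,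
      ∑ J ∈ G n, ‖F J - ∫ s in Icc J.1 J.2, g s‖ < ε := by
  set μ := volume.restrict (Icc a b)
  have hu : ∀ n, Integrable (stepFun (G n) (boxAverage F)) μ := fun n =>
    (integrable_stepFun _ _).restrict
  have hcauchy : CauchySeq fun n => (hu n).toL1 _ := by
    rw [EMetric.cauchySeq_iff']
    intro ε hε
    obtain ⟨η, hη0, hη⟩ := ENNReal.lt_iff_exists_nnreal_btwn.1 (ENNReal.half_pos hε.ne')
    obtain ⟨δ, hδ, hδF⟩ := hF η (by exact_mod_cast hη0)
    obtain ⟨N, hN⟩ := hG.exists_tag hδ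
    have : Nonempty E := ⟨a⟩
    choose! τ hτ hτδ using hN N le_rfl
    have hv : Integrable (stepFun (G N) fun J => f (τ J)) μ := (integrable_stepFun _ _).restrict
    have key : ∀ n ≥ N, edist ((hu n).toL1 _) (hv.toL1 _) < ε / 2 := by
      intro n hn
      rw [Integrable.edist_toL1_toL1]
      refine lt_of_le_of_lt ?_ hη
      simp only [edist_eq_enorm_sub]
      simpa using hG.setLIntegral_stepFun_boxAverage_le hfr hδF hn hτ hτδ
    refine ⟨N, fun n hn => (edist_triangle_right _ _ (hv.toL1 _)).trans_lt ?_⟩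
    rw [← ENNReal.add_halves ε]
    exact ENNReal.add_lt_add (key n hn) (key N le_rfl)
  obtain ⟨L, hL⟩ := cauchySeq_tendsto_of_complete hcauchy
  have hLi : Integrable L μ := L1.integrable_coeFn L
  refine ⟨L, hLi, fun ε hε => ?_⟩
  obtain ⟨N, hN⟩ := EMetric.tendsto_atTop.1 hL (ENNReal.ofReal ε) (by simpa using hε)
  refine ⟨N, fun n hn => ?_⟩
  have h1 := hN n hn
  nth_rw 1 [← Integrable.toL1_coeFn L hLi] at h1
  rw [Integrable.edist_toL1_toL1] at h1
  simp only [edist_eq_enorm_sub] at h1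
  rw [← ENNReal.ofReal_lt_ofReal_iff hε, ENNReal.ofReal_sum_of_nonneg fun _ _ => norm_nonneg _]
  refine lt_of_le_of_lt ?_ h1
  rw [← hG.sum_setLIntegral hfr n]
  refine Finset.sum_le_sum fun J hJ => ?_
  have hFJ : ∫ s in Icc J.1 J.2, stepFun (G n) (boxAverage F) s = F J := by
    rw [← setIntegral_congr_set (interior_ae_eq_of_null_frontier (hfr J.1 J.2)),
      setIntegral_congr_fun isOpen_interior.measurableSet (g := fun _ => boxAverage F J)
        (fun s hs => hG.stepFun_eq _ hJ hs),
      setIntegral_const, measureReal_def,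
      measure_congr (interior_ae_eq_of_null_frontier (hfr J.1 J.2)), boxAverage,
      smul_inv_smul₀ (hG.volume_toReal_pos hJ).ne']
  rw [ofReal_norm, ← hFJ, ← integral_sub (integrable_stepFun _ _).restrict
    (IntegrableOn.mono_set hLi (hG.isSubinterval n J hJ).1)]
  exact enorm_integral_le_lintegral_enorm _

/-- A strong approximation of the sums of `f` by those of an integrable function forces `f` to
agree with it almost everywhere. -/
theorem IsGridSeq.ae_eq_of_limit [CompleteSpace X] (hG : IsGridSeq a b G)
    (hfr : ∀ p q : E, volume (frontier (Icc p q)) = 0)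
    (hF : ∀ ε > 0, ∃ δ : E → ℝ, IsGauge (Icc a b) δ ∧
      ∀ P, IsMPartition (Icc a b) P → IsFine δ P →
        ∑ x ∈ P, ‖(volume (itemBox x)).toReal • f x.1 - F (x.2.1, x.2.2)‖ < ε)
    {g : E → X} (hg : IntegrableOn g (Icc a b)) (hFg : ∀ ε > 0, ∃ N, ∀ n ≥ N,
      ∑ J ∈ G n, ‖F J - ∫ s in Icc J.1 J.2, g s‖ < ε) :
    f =ᵐ[volume.restrict (Icc a b)] g := by
  have main : ∀ η > 0, volume {t ∈ Icc a b | η ≤ ‖f t - g t‖} = 0 := by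
    intro η hη
    set A := {t ∈ Icc a b | η ≤ ‖f t - g t‖} with hA
    have hbound : ∀ ε : NNReal, 0 < ε → volume A ≤ ε := by
      intro ε hε
      have hε3 : 0 < η * ε / 3 := by positivity
      obtain ⟨δ₁, hδ₁, h₁⟩ := hF _ hε3
      obtain ⟨δ₂, hδ₂, h₂⟩ := hg.exists_gauge hfr hε3
      set δ : E → ℝ := fun t => min (δ₁ t) (δ₂ t)
      have hδ : IsGauge (Icc a b) δ := fun t ht => lt_min (hδ₁ t ht) (hδ₂ t)
      have hAU : A = ⋃ k : ℕ, {t ∈ A | 1 / ((k : ℝ) + 1) < δ t} := by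
        ext t
        simp only [mem_iUnion, mem_ofPred_eq]
        exact ⟨fun ht => (exists_nat_one_div_lt (hδ t ht.1)).imp fun k hk => ⟨ht, hk⟩,
          fun ⟨_, ht, _⟩ => ht⟩
      have hmono : Monotone fun k : ℕ => {t ∈ A | 1 / ((k : ℝ) + 1) < δ t} :=
        fun k l hkl t ht => ⟨ht.1, (one_div_le_one_div_of_le (by positivity)
          (by gcongr)).trans_lt ht.2⟩
      rw [hAU, hmono.measure_iUnion]
      refine iSup_le fun k => ?_
      set B := {t ∈ A | 1 / ((k : ℝ) + 1) < δ t}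
      obtain ⟨N₁, hN₁⟩ := hG.exists_tag hδ
      obtain ⟨N₂, hN₂⟩ := hG.mesh (1 / ((k : ℝ) + 1)) (by positivity)
      obtain ⟨N₃, hN₃⟩ := hFg _ hε3
      set n := max N₁ (max N₂ N₃)
      have htag : ∀ J ∈ G n, ∃ t ∈ Icc a b, Icc J.1 J.2 ⊆ Metric.ball t (δ t) ∧
          ((Icc J.1 J.2 ∩ B).Nonempty → t ∈ B) := by
        intro J hJ
        by_cases hne : (Icc J.1 J.2 ∩ B).Nonempty
        · obtain ⟨t, htJ, htB⟩ := hne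
          exact ⟨t, htB.1.1, (hN₂ n (by simp [n]) J hJ t htJ).trans
            (Metric.ball_subset_ball htB.2.le), fun _ => htB⟩
        · obtain ⟨t, ht, htb⟩ := hN₁ n (by simp [n]) J hJ
          exact ⟨t, ht, htb, fun h => absurd h hne⟩
      have : Nonempty E := ⟨a⟩
      choose! τ hτ hτδ hτB using htag
      have s₁ := hG.sum_lt h₁ hτ
        fun J hJ => (hτδ J hJ).trans (Metric.ball_subset_ball (min_le_left _ _))
      have s₂ := hG.sum_lt h₂ hτ
        fun J hJ => (hτδ J hJ).trans (Metric.ball_subset_ball (min_le_right _ _))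
      have s₃ := hN₃ n (by simp [n])
      simp only [itemBox] at s₁ s₂
      have s : ∑ J ∈ G n, (volume (Icc J.1 J.2)).toReal * ‖f (τ J) - g (τ J)‖ < η * ε := by
        calc _ ≤ ∑ J ∈ G n, (‖(volume (Icc J.1 J.2)).toReal • f (τ J) - F J‖
                + ‖(volume (Icc J.1 J.2)).toReal • g (τ J) - ∫ s in Icc J.1 J.2, g s‖
                + ‖F J - ∫ s in Icc J.1 J.2, g s‖) := by
              refine Finset.sum_le_sum fun J _ => ?_
              rw [← Real.norm_of_nonneg (ENNReal.toReal_nonneg (a := volume (Icc J.1 J.2))),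
                ← norm_smul, Real.norm_of_nonneg ENNReal.toReal_nonneg, smul_sub]
              set x := (volume (Icc J.1 J.2)).toReal • f (τ J)
              set y := (volume (Icc J.1 J.2)).toReal • g (τ J)
              set z := ∫ s in Icc J.1 J.2, g s
              calc ‖x - y‖ = ‖(x - F J) - (y - z) + (F J - z)‖ := by congr 1; abel
                _ ≤ _ := (norm_add_le _ _).trans (by gcongr; exact norm_sub_le _ _)
          _ < η * ε := by
              rw [Finset.sum_add_distrib, Finset.sum_add_distrib]
              linarith
      classical
      set S := (G n).filter fun J => (Icc J.1 J.2 ∩ B).Nonempty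
      have hBS : B ⊆ ⋃ J ∈ S, Icc J.1 J.2 := by
        intro t ht
        obtain ⟨J, hJ, htJ⟩ := mem_iUnion₂.1 ((hG.iUnion_eq n).symm.subset ht.1.1)
        exact mem_iUnion₂.2 ⟨J, Finset.mem_filter.2 ⟨hJ, t, htJ, ht⟩, htJ⟩
      have hS : ∑ J ∈ S, (volume (Icc J.1 J.2)).toReal ≤ ε := by
        have : η * ∑ J ∈ S, (volume (Icc J.1 J.2)).toReal ≤ η * ε := by
          refine le_trans ?_ s.le
          rw [Finset.mul_sum]
          refine (Finset.sum_le_sum fun J hJ => ?_).trans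
            (Finset.sum_le_sum_of_subset_of_nonneg (Finset.filter_subset _ _)
              fun _ _ _ => by positivity)
          rw [mul_comm]
          have hJ' := Finset.mem_filter.1 hJ
          gcongr
          exact (hτB J hJ'.1 hJ'.2).1.2
        exact le_of_mul_le_mul_left this hη
      calc volume B ≤ ∑ J ∈ S, volume (Icc J.1 J.2) :=
            (measure_mono hBS).trans (measure_biUnion_finset_le _ _)
        _ = ENNReal.ofReal (∑ J ∈ S, (volume (Icc J.1 J.2)).toReal) := by
            rw [ENNReal.ofReal_sum_of_nonneg fun _ _ => ENNReal.toReal_nonneg]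
            exact Finset.sum_congr rfl fun J _ =>
              (ENNReal.ofReal_toReal isCompact_Icc.measure_lt_top.ne).symm
        _ ≤ ε := by
            rw [← ENNReal.ofReal_coe_nnreal]
            exact ENNReal.ofReal_le_ofReal hS
    exact le_antisymm (ENNReal.le_of_forall_pos_le_add fun ε hε _ => by simpa using hbound ε hε)
      zero_le
  rw [Filter.EventuallyEq, ae_restrict_iff' isClosed_Icc.measurableSet, ae_iff]
  refine measure_mono_null (t := ⋃ k : ℕ, {t ∈ Icc a b | 1 / ((k : ℝ) + 1) ≤ ‖f t - g t‖})
    (fun t ht => ?_) (measure_iUnion_null fun k => main _ (by positivity))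
  simp only [mem_ofPred_eq, Classical.not_imp] at ht
  obtain ⟨k, hk⟩ := exists_nat_one_div_lt (norm_pos_iff.2 (sub_ne_zero.2 ht.2))
  exact mem_iUnion.2 ⟨k, ht.1, hk.le⟩

theorem HasStrongMcShaneIntegral.integrableOn_s16 [CompleteSpace X] {v : X}
    (h : HasStrongMcShaneIntegral a b f v)
    (hfr : ∀ p q : E, volume (frontier (Icc p q)) = 0) (hG : IsGridSeq a b G)
    (hsum : ∀ F : E × E → X, IsAdditiveIntervalFun (Icc a b) F →
      ∀ n, ∑ J ∈ G n, F J = F (a, b)) :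
    IntegrableOn f (Icc a b) ∧ ∫ s in Icc a b, f s = v := by
  obtain ⟨F, hFadd, hFv, hF⟩ := h
  obtain ⟨g, hg, hFg⟩ := hG.exists_limit hfr hF
  have hfg := hG.ae_eq_of_limit hfr hF hg hFg
  refine ⟨hg.congr hfg.symm, ?_⟩
  rw [integral_congr_ae hfg]
  refine (eq_of_forall_dist_le fun ε hε => ?_).symm
  obtain ⟨N, hN⟩ := hFg ε hε
  calc dist v (∫ s in Icc a b, g s) = ‖∑ J ∈ G N, (F J - ∫ s in Icc J.1 J.2, g s)‖ := by
        rw [Finset.sum_sub_distrib, hsum F hFadd N, hFv,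
          hsum _ (hg.isAdditiveIntervalFun hfr) N, dist_eq_norm]
    _ ≤ ε := (norm_sum_le _ _).trans (hN N le_rfl).le

end StrongToBochner

end Generic

section Grids

theorem volume_frontier_Icc_real (p q : ℝ) : volume (frontier (Icc p q)) = 0 :=
  (convex_Icc p q).addHaar_frontier volume

theorem volume_frontier_Icc_real_prod (p q : ℝ × ℝ) : volume (frontier (Icc p q)) = 0 :=
  (convex_Icc p q).addHaar_frontier volume

/-- The `k`-th node of the uniform subdivision of `[a, b]` into `2 ^ n` pieces. -/
noncomputable def dyadicNode (a b : ℝ) (n k : ℕ) : ℝ := a + k * ((b - a) / 2 ^ n)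

/-- The uniform subdivision of `[a, b]` into `2 ^ n` pieces. -/
noncomputable def dyadicGrid (a b : ℝ) (n : ℕ) : Finset (ℝ × ℝ) :=
  (Finset.range (2 ^ n)).image fun k => (dyadicNode a b n k, dyadicNode a b n (k + 1))

variable {a b : ℝ}

theorem dyadicNode_strictMono (hab : a < b) (n : ℕ) : StrictMono (dyadicNode a b n) := by
  intro k l hkl
  have h : 0 < (b - a) / 2 ^ n := div_pos (sub_pos.2 hab) (by positivity)
  have : (k : ℝ) < l := by exact_mod_cast hkl
  simp only [dyadicNode]
  gcongr

theorem dyadicNode_zero (n : ℕ) : dyadicNode a b n 0 = a := by simp [dyadicNode]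

theorem dyadicNode_two_pow (n : ℕ) : dyadicNode a b n (2 ^ n) = b := by
  simp only [dyadicNode, Nat.cast_pow, Nat.cast_ofNat]
  field_simp
  ring

theorem dyadicNode_mul (m d k : ℕ) : dyadicNode a b (m + d) (2 ^ d * k) = dyadicNode a b m k := by
  simp only [dyadicNode, Nat.cast_mul, Nat.cast_pow, Nat.cast_ofNat, pow_add]
  field_simp

theorem isSubinterval_dyadicNode (hab : a < b) {n k l : ℕ} (hkl : k < l) (hl : l ≤ 2 ^ n) :
    IsSubinterval (Icc a b) (dyadicNode a b n k) (dyadicNode a b n l) := by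
  have hmono := dyadicNode_strictMono hab n
  refine ⟨Icc_subset_Icc ?_ ?_, by rw [interior_Icc]; exact nonempty_Ioo.2 (hmono hkl)⟩
  · exact (dyadicNode_zero n).symm.trans_le (hmono.monotone (Nat.zero_le k))
  · exact (hmono.monotone hl).trans_eq (dyadicNode_two_pow n)

theorem biUnion_Icc_dyadicNode (hab : a < b) (n j : ℕ) :
    ⋃ k ∈ Finset.range (j + 1), Icc (dyadicNode a b n k) (dyadicNode a b n (k + 1))
      = Icc (dyadicNode a b n 0) (dyadicNode a b n (j + 1)) := by
  have hmono := (dyadicNode_strictMono hab n).monotone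
  induction j with
  | zero => simp
  | succ j ih =>
    rw [Finset.range_add_one, Finset.set_biUnion_insert, ih, union_comm,
      Icc_union_Icc_eq_Icc (hmono (Nat.zero_le _)) (hmono (Nat.le_succ _))]

theorem sum_dyadicNode (hab : a < b) {F : ℝ × ℝ → X} (hF : IsAdditiveIntervalFun (Icc a b) F)
    (n j : ℕ) (hj : j < 2 ^ n) :
    ∑ k ∈ Finset.range (j + 1), F (dyadicNode a b n k, dyadicNode a b n (k + 1))
      = F (dyadicNode a b n 0, dyadicNode a b n (j + 1)) := by
  have hmono := (dyadicNode_strictMono hab n).monotone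
  induction j with
  | zero => simp
  | succ j ih =>
    rw [Finset.sum_range_succ, ih (by omega)]
    refine (hF _ _ _ _ _ _ (isSubinterval_dyadicNode hab (by omega) (by omega))
      (isSubinterval_dyadicNode hab (by omega) (by omega))
      (isSubinterval_dyadicNode hab (by omega) (by omega)) ?_
      (Icc_union_Icc_eq_Icc (hmono (Nat.zero_le _)) (hmono (Nat.le_succ _)))).symm
    rw [interior_Icc, interior_Icc, Ioo_inter_Ioo]
    exact Ioo_eq_empty (by simp)

theorem isGridSeq_dyadicGrid (hab : a < b) : IsGridSeq a b (dyadicGrid a b) where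
  isSubinterval n := by
    simp only [dyadicGrid, Finset.forall_mem_image, Finset.mem_range]
    exact fun k hk => isSubinterval_dyadicNode hab k.lt_succ_self hk
  inter_eq n := by
    simp only [dyadicGrid, Finset.forall_mem_image, interior_Icc]
    have key : ∀ k l, k < l → Ioo (dyadicNode a b n k) (dyadicNode a b n (k + 1)) ∩
        Ioo (dyadicNode a b n l) (dyadicNode a b n (l + 1)) = ∅ := fun k l hkl => by
      have := (dyadicNode_strictMono hab n).monotone (Nat.succ_le_of_lt hkl)
      refine eq_empty_of_forall_notMem fun x hx => ?_
      exact (hx.1.2.trans_le this).not_gt hx.2.1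
    intro k _ l _ hkl
    rcases lt_trichotomy k l with h | h | h
    · exact key k l h
    · exact absurd (by rw [h]) hkl
    · rw [inter_comm]
      exact key l k h
  iUnion_eq n := by
    obtain ⟨j, hj⟩ := Nat.exists_eq_add_one.2 (Nat.two_pow_pos n)
    rw [dyadicGrid, Finset.set_biUnion_finset_image, hj]
    simp only
    rw [biUnion_Icc_dyadicNode hab, ← hj, dyadicNode_zero, dyadicNode_two_pow]
  nested m n hmn := by
    obtain ⟨d, rfl⟩ := Nat.exists_eq_add_of_le hmn
    simp only [dyadicGrid, Finset.forall_mem_image, Finset.exists_mem_image, Finset.mem_range]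
    intro k hk
    have hmono := (dyadicNode_strictMono hab (m + d)).monotone
    refine ⟨k / 2 ^ d, Nat.div_lt_of_lt_mul (by rwa [← pow_add, add_comm]), ?_⟩
    rw [← dyadicNode_mul m d, ← dyadicNode_mul m d]
    exact Icc_subset_Icc (hmono (Nat.mul_div_le k _))
      (hmono (Nat.lt_mul_div_succ k (Nat.two_pow_pos d)))
  mesh r hr := by
    obtain ⟨N, hN⟩ := pow_unbounded_of_one_lt ((b - a) / r) one_lt_two
    refine ⟨N, fun n hn => ?_⟩
    simp only [dyadicGrid, Finset.forall_mem_image]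
    intro k _ x hx y hy
    have h1 : (b - a) / 2 ^ n < r := by
      rw [div_lt_iff₀ (by positivity), mul_comm, ← div_lt_iff₀ hr]
      exact hN.trans_le (pow_le_pow_right₀ one_le_two hn)
    rw [Metric.mem_ball]
    refine (Real.dist_le_of_mem_Icc hy hx).trans_lt (lt_of_eq_of_lt ?_ h1)
    simp only [dyadicNode, Nat.cast_add, Nat.cast_one]
    ring

theorem sum_dyadicGrid (hab : a < b) {F : ℝ × ℝ → X} (hF : IsAdditiveIntervalFun (Icc a b) F)
    (n : ℕ) : ∑ J ∈ dyadicGrid a b n, F J = F (a, b) := by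
  rw [dyadicGrid, Finset.sum_image]
  · obtain ⟨j, hj⟩ := Nat.exists_eq_add_one.2 (Nat.two_pow_pos n)
    rw [hj, sum_dyadicNode hab hF n j (by omega), ← hj, dyadicNode_zero, dyadicNode_two_pow]
  · intro k _ l _ hkl
    exact (dyadicNode_strictMono hab n).injective (Prod.ext_iff.1 hkl).1

/-- The box with sides `I` and `J`, as a pair of corners. -/
def boxProd (x : (ℝ × ℝ) × (ℝ × ℝ)) : (ℝ × ℝ) × (ℝ × ℝ) := ((x.1.1, x.2.1), (x.1.2, x.2.2))

theorem boxProd_injective : Function.Injective boxProd := by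
  rintro ⟨⟨_, _⟩, ⟨_, _⟩⟩ ⟨⟨_, _⟩, ⟨_, _⟩⟩ h
  simp only [boxProd, Prod.mk.injEq] at h ⊢
  tauto

theorem IsSubinterval.prod {K L : Set ℝ} {p q r s : ℝ} (h₁ : IsSubinterval K p q)
    (h₂ : IsSubinterval L r s) : IsSubinterval (K ×ˢ L) ((p, r) : ℝ × ℝ) (q, s) := by
  rw [IsSubinterval, ← Icc_prod_Icc, interior_prod_eq]
  exact ⟨prod_mono h₁.1 h₂.1, h₁.2.prod h₂.2⟩

theorem IsGridSeq.prod {a₁ b₁ a₂ b₂ : ℝ} {G₁ G₂ : ℕ → Finset (ℝ × ℝ)}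
    (h₁ : IsGridSeq a₁ b₁ G₁) (h₂ : IsGridSeq a₂ b₂ G₂) :
    IsGridSeq ((a₁, a₂) : ℝ × ℝ) (b₁, b₂) fun n => (G₁ n ×ˢ G₂ n).image boxProd where
  isSubinterval n := by
    simp only [Finset.forall_mem_image, Finset.mem_product, ← Icc_prod_Icc]
    exact fun x hx => (h₁.isSubinterval n _ hx.1).prod (h₂.isSubinterval n _ hx.2)
  inter_eq n := by
    simp only [Finset.forall_mem_image, Finset.mem_product, boxProd, ← Icc_prod_Icc,
      interior_prod_eq, prod_inter_prod]
    rintro ⟨I, J⟩ hx ⟨I', J'⟩ hy hxy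
    by_cases hI : I = I'
    · have hJ : J ≠ J' := fun h => hxy (by rw [hI, h])
      rw [h₂.inter_eq n _ hx.2 _ hy.2 hJ, prod_empty]
    · rw [h₁.inter_eq n _ hx.1 _ hy.1 hI, empty_prod]
  iUnion_eq n := by
    rw [Finset.set_biUnion_finset_image, ← Icc_prod_Icc, ← h₁.iUnion_eq n, ← h₂.iUnion_eq n]
    ext ⟨x, y⟩
    simp only [boxProd, ← Icc_prod_Icc, mem_iUnion, Finset.mem_product, mem_prod, exists_prop,
      Prod.exists]
    constructor
    · rintro ⟨p, q, r, s, ⟨hI, hJ⟩, hx, hy⟩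
      exact ⟨⟨p, q, hI, hx⟩, ⟨r, s, hJ, hy⟩⟩
    · rintro ⟨⟨p, q, hI, hx⟩, ⟨r, s, hJ, hy⟩⟩
      exact ⟨p, q, r, s, ⟨hI, hJ⟩, hx, hy⟩
  nested m n hmn := by
    simp only [Finset.forall_mem_image, Finset.exists_mem_image, Finset.mem_product]
    intro x hx
    obtain ⟨I, hI, hxI⟩ := h₁.nested m n hmn _ hx.1
    obtain ⟨J, hJ, hxJ⟩ := h₂.nested m n hmn _ hx.2
    refine ⟨(I, J), ⟨hI, hJ⟩, ?_⟩
    simp only [boxProd, ← Icc_prod_Icc]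
    exact prod_mono hxI hxJ
  mesh r hr := by
    obtain ⟨N₁, hN₁⟩ := h₁.mesh r hr
    obtain ⟨N₂, hN₂⟩ := h₂.mesh r hr
    refine ⟨max N₁ N₂, fun n hn => ?_⟩
    simp only [Finset.forall_mem_image, Finset.mem_product, boxProd, ← Icc_prod_Icc]
    intro x hx z hz
    rw [← ball_prod_same]
    exact prod_mono (hN₁ n (le_of_max_le_left hn) _ hx.1 _ hz.1)
      (hN₂ n (le_of_max_le_right hn) _ hx.2 _ hz.2)

theorem sum_dyadicGrid_prod {a₁ b₁ a₂ b₂ : ℝ} (hab₁ : a₁ < b₁) (hab₂ : a₂ < b₂)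
    {F : (ℝ × ℝ) × (ℝ × ℝ) → X}
    (hF : IsAdditiveIntervalFun (Icc ((a₁, a₂) : ℝ × ℝ) (b₁, b₂)) F) (n : ℕ) :
    ∑ J ∈ (dyadicGrid a₁ b₁ n ×ˢ dyadicGrid a₂ b₂ n).image boxProd, F J
      = F ((a₁, a₂), (b₁, b₂)) := by
  rw [← Icc_prod_Icc] at hF
  have hK₂ : IsSubinterval (Icc a₂ b₂) a₂ b₂ :=
    ⟨subset_rfl, by rw [interior_Icc]; exact nonempty_Ioo.2 hab₂⟩
  rw [Finset.sum_image boxProd_injective.injOn, Finset.sum_product]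
  have hinner : ∀ I ∈ dyadicGrid a₁ b₁ n,
      ∑ J ∈ dyadicGrid a₂ b₂ n, F (boxProd (I, J)) = F (boxProd (I, (a₂, b₂))) := by
    intro I hI
    have hI' := (isGridSeq_dyadicGrid hab₁).isSubinterval n I hI
    refine sum_dyadicGrid hab₂ (F := fun J => F (boxProd (I, J))) ?_ n
    intro p q r s u w hpq hrs huw hd hU
    refine hF _ _ _ _ _ _ (hI'.prod hpq) (hI'.prod hrs) (hI'.prod huw) ?_ ?_
    · simp only [← Icc_prod_Icc, interior_prod_eq, prod_inter_prod, hd, prod_empty]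
    · simp only [← Icc_prod_Icc, ← prod_union, hU]
  rw [Finset.sum_congr rfl hinner]
  refine sum_dyadicGrid hab₁ (F := fun I => F (boxProd (I, (a₂, b₂)))) ?_ n
  intro p q r s u w hpq hrs huw hd hU
  refine hF _ _ _ _ _ _ (hpq.prod hK₂) (hrs.prod hK₂) (huw.prod hK₂) ?_ ?_
  · simp only [← Icc_prod_Icc, interior_prod_eq, prod_inter_prod, hd, empty_prod]
  · simp only [← Icc_prod_Icc, ← union_prod, hU]

end Grids

/-- On a compact interval, strong McShane integrability is Bochner integrability. -/
theorem exists_hasStrongMcShaneIntegral_iff [CompleteSpace X] {a b : ℝ} (hab : a < b)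
    {f : ℝ → X} : (∃ u, HasStrongMcShaneIntegral a b f u) ↔ IntegrableOn f (Icc a b) :=
  ⟨fun ⟨_, hu⟩ => (hu.integrableOn_s16 volume_frontier_Icc_real (isGridSeq_dyadicGrid hab)
    fun _ hF n => sum_dyadicGrid hab hF n).1,
    fun h => ⟨_, h.hasStrongMcShaneIntegral volume_frontier_Icc_real⟩⟩

/-- Theorem 2.1(iii): `h(t₂) = ∫_{[a₁,b₁]} (f₀)_{t₂}` is strongly
integrable on `[a₂,b₂]` and its integral equals `∫_{[a,b]} f = v`. -/
theorem fubini_main_mcShane_snd {X : Type*} [NormedAddCommGroup X] [NormedSpace ℝ X] [CompleteSpace X] (a₁ b₁ a₂ b₂ : ℝ) (hab₁ : a₁ < b₁) (hab₂ : a₂ < b₂)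
    (f : ℝ × ℝ → X) (v : X)
    (hf : HasStrongMcShaneIntegral ((a₁, a₂) : ℝ × ℝ) (b₁, b₂) f v)
    (Z₁ : Set ℝ) (hZ₁ : Z₁ = {t₁ : ℝ | t₁ ∈ Set.Icc a₁ b₁ ∧ ¬ ∃ u : X, HasStrongMcShaneIntegral a₂ b₂ (fun s₂ => f (t₁, s₂)) u})
    (Z₂ : Set ℝ) (hZ₂ : Z₂ = {t₂ : ℝ | t₂ ∈ Set.Icc a₂ b₂ ∧ ¬ ∃ u : X, HasStrongMcShaneIntegral a₁ b₁ (fun s₁ => f (s₁, t₂)) u})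
    (Z : Set (ℝ × ℝ)) (hZ : Z = (Z₁ ×ˢ Set.Icc a₂ b₂) ∪ ((Set.Icc a₁ b₁) ×ˢ Z₂))
    (f₀ : ℝ × ℝ → X) (hf₀ : f₀ = ((Set.Icc ((a₁, a₂) : ℝ × ℝ) (b₁, b₂)) \ Z).indicator f) :
    ∃ h : ℝ → X,
      (∀ t₂ ∈ Set.Icc a₂ b₂, HasStrongMcShaneIntegral a₁ b₁ (fun s₁ => f₀ (s₁, t₂)) (h t₂)) ∧
      HasStrongMcShaneIntegral a₂ b₂ h v := by
  have hf' := hf.integrableOn_s16 volume_frontier_Icc_real_prod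
    ((isGridSeq_dyadicGrid hab₁).prod (isGridSeq_dyadicGrid hab₂))
    fun _ hF n => sum_dyadicGrid_prod hab₁ hab₂ hF n
  set μ₁ := volume.restrict (Icc a₁ b₁) with hμ₁
  set μ₂ := volume.restrict (Icc a₂ b₂) with hμ₂
  have hμ : volume.restrict (Icc ((a₁, a₂) : ℝ × ℝ) (b₁, b₂)) = μ₁.prod μ₂ := by
    rw [hμ₁, hμ₂, Measure.prod_restrict, Icc_prod_Icc, Measure.volume_eq_prod]
  rw [IntegrableOn, hμ] at hf'
  obtain ⟨hfi, hfv⟩ := hf'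
  have hZ₁' : ∀ᵐ s ∂μ₁, s ∉ Z₁ := by
    filter_upwards [hfi.prod_right_ae] with s hs
    rw [hZ₁]
    exact fun h => h.2 ((exists_hasStrongMcShaneIntegral_iff hab₂).2 hs)
  have hZ₂' : ∀ᵐ t ∂μ₂, t ∉ Z₂ := by
    filter_upwards [hfi.prod_left_ae] with t ht
    rw [hZ₂]
    exact fun h => h.2 ((exists_hasStrongMcShaneIntegral_iff hab₁).2 ht)
  have hf₀mem : ∀ s ∈ Icc a₁ b₁, ∀ t ∈ Icc a₂ b₂, s ∉ Z₁ → t ∉ Z₂ → f₀ (s, t) = f (s, t) := by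
    intro s hs t ht hsZ htZ
    rw [hf₀, indicator_of_mem]
    rw [← Icc_prod_Icc, hZ]
    refine ⟨⟨hs, ht⟩, ?_⟩
    rintro (h | h)
    exacts [hsZ h.1, htZ h.2]
  have hae : f₀ =ᵐ[μ₁.prod μ₂] f := by
    have h₁ : ∀ᵐ z ∂μ₁.prod μ₂, z.1 ∉ Z₁ := Measure.quasiMeasurePreserving_fst.ae hZ₁'
    have h₂ : ∀ᵐ z ∂μ₁.prod μ₂, z.2 ∉ Z₂ := Measure.quasiMeasurePreserving_snd.ae hZ₂'
    have h₃ : ∀ᵐ z ∂μ₁.prod μ₂, z ∈ Icc ((a₁, a₂) : ℝ × ℝ) (b₁, b₂) := by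
      rw [← hμ]
      exact ae_restrict_mem isClosed_Icc.measurableSet
    filter_upwards [h₁, h₂, h₃] with z hz₁ hz₂ hz
    rw [← Icc_prod_Icc] at hz
    exact hf₀mem z.1 hz.1 z.2 hz.2 hz₁ hz₂
  have hf₀i : Integrable f₀ (μ₁.prod μ₂) := hfi.congr hae.symm
  refine ⟨fun t => ∫ s in Icc a₁ b₁, f₀ (s, t), fun t ht => ?_, ?_⟩
  · refine IntegrableOn.hasStrongMcShaneIntegral volume_frontier_Icc_real ?_
    by_cases htZ : t ∈ Z₂
    · refine integrableOn_zero.congr_fun (fun s hs => ?_) measurableSet_Icc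
      rw [hf₀, indicator_of_notMem]
      exact fun h => h.2 (hZ ▸ Or.inr ⟨hs, htZ⟩)
    · have hft : IntegrableOn (fun s => f (s, t)) (Icc a₁ b₁) := by
        rw [← exists_hasStrongMcShaneIntegral_iff hab₁]
        by_contra h
        exact htZ (hZ₂ ▸ ⟨ht, h⟩)
      refine Integrable.congr hft ?_
      filter_upwards [hZ₁', ae_restrict_mem measurableSet_Icc] with s hsZ hs
      exact (hf₀mem s hs t ht hsZ htZ).symm
  · have hv : ∫ t in Icc a₂ b₂, ∫ s in Icc a₁ b₁, f₀ (s, t) = v := by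
      rw [← hfv, ← integral_congr_ae hae, integral_prod_symm f₀ hf₀i]
    rw [← hv]
    exact IntegrableOn.hasStrongMcShaneIntegral volume_frontier_Icc_real hf₀i.integral_prod_right
end
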